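/- arXiv:2604.23306 — 4 statements merged into one kernel-verified Lean document; each statement's English description precedes it below -/
import Mathlib

section
/- Let n ≥ 1, let a < b, let g_1, …, g_{2n} be continuous real-valued functions forming a Tchebyshev system on [a,b], and let ω be a continuous, strictly positive weight function on [a,b]. Then there exist nodes a ≤ x_1 < … < x_n ≤ b and strictly positive weights w_1, …, w_n such that ∫_a^b g_j(x)ω(x) dx = Σ_{k=1}^n w_k g_j(x_k) for every j = 1, …, 2n (i.e., an n-point generalised Gauss quadrature rule exact for g_1, …, g_{2n} with positive weights exists). -/
open MeasureTheory

/-- `g 0, …, g (m-1)` form a Tchebyshev system on `[a,b]`: for every choice of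
distinct (increasing) points in `[a,b]` the corresponding Vandermonde-type matrix
has nonzero determinant. -/
def IsTchebyshevSystem (a b : ℝ) {m : ℕ} (g : Fin m → ℝ → ℝ) : Prop :=
  ∀ y : Fin m → ℝ, StrictMono y → (∀ i, y i ∈ Set.Icc a b) →
    (Matrix.of fun i j => g j (y i)).det ≠ 0


/-- Finset form of the Tchebyshev property for a curve `G`. -/
def ChebProp (a b : ℝ) {N : ℕ} (G : ℝ → Fin N → ℝ) : Prop :=
  ∀ (p : Fin N → ℝ) (Z : Finset ℝ), (∀ z ∈ Z, z ∈ Set.Icc a b) → N ≤ Z.card →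
    (∀ z ∈ Z, dotProduct p (G z) = 0) → p = 0

lemma exists_pad {a b : ℝ} (hab : a < b) (Z : Finset ℝ) (hZ : ∀ z ∈ Z, z ∈ Set.Icc a b)
    (k : ℕ) (hk : Z.card ≤ k) :
    ∃ Z' : Finset ℝ, Z ⊆ Z' ∧ (∀ z ∈ Z', z ∈ Set.Icc a b) ∧ Z'.card = k := by
  induction k, hk using Nat.le_induction with
  | base => exact ⟨Z, subset_rfl, hZ, rfl⟩
  | succ k hk ih =>
    obtain ⟨Z', h1, h2, h3⟩ := ih
    obtain ⟨x, hx, hx'⟩ := (Set.Icc_infinite hab).exists_notMem_finset Z'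
    refine ⟨insert x Z', h1.trans (Finset.subset_insert _ _), ?_, by
      rw [Finset.card_insert_of_notMem hx', h3]⟩
    intro z hz
    rcases Finset.mem_insert.1 hz with rfl | hz
    · exact hx
    · exact h2 z hz

lemma interp {a b : ℝ} (hab : a < b) {N : ℕ} {G : ℝ → Fin N → ℝ} (H : ChebProp a b G)
    (Z : Finset ℝ) (hZ : ∀ z ∈ Z, z ∈ Set.Icc a b) (hc : Z.card ≤ N) (v : ℝ → ℝ) :
    ∃ q : Fin N → ℝ, ∀ z ∈ Z, dotProduct q (G z) = v z := by
  obtain ⟨Z', h1, h2, h3⟩ := exists_pad hab Z hZ N hc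
  let T : (Fin N → ℝ) →ₗ[ℝ] (Z' → ℝ) :=
    { toFun := fun p z => dotProduct p (G z)
      map_add' := by intro p q; ext z; simp [add_dotProduct]
      map_smul' := by intro c q; ext z; simp [smul_dotProduct] }
  have hinj : Function.Injective T := by
    rw [← LinearMap.ker_eq_bot, LinearMap.ker_eq_bot']
    intro p hp
    refine H p Z' h2 h3.ge ?_
    intro z hz
    exact congrFun hp ⟨z, hz⟩
  have hsurj : Function.Surjective T := by
    refine (LinearMap.injective_iff_surjective_of_finrank_eq_finrank ?_).1 hinj
    simp [h3]
  obtain ⟨q, hq⟩ := hsurj (fun z => v z)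
  exact ⟨q, fun z hz => congrFun hq ⟨z, h1 hz⟩⟩

lemma indep {a b : ℝ} (hab : a < b) {N : ℕ} {G : ℝ → Fin N → ℝ} (H : ChebProp a b G)
    (Z : Finset ℝ) (hZ : ∀ z ∈ Z, z ∈ Set.Icc a b) (hc : Z.card ≤ N) (w : ℝ → ℝ)
    (h0 : ∑ z ∈ Z, w z • G z = 0) : ∀ z ∈ Z, w z = 0 := by
  obtain ⟨q, hq⟩ := interp hab H Z hZ hc w
  have h : dotProduct q (∑ z ∈ Z, w z • G z) = 0 := by rw [h0]; simp
  rw [dotProduct_sum] at h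
  have h' : ∑ z ∈ Z, w z * w z = 0 := by
    rw [← h]
    refine Finset.sum_congr rfl fun z hz => ?_
    rw [dotProduct_smul, hq z hz, smul_eq_mul]
  intro z hz
  have := (Finset.sum_eq_zero_iff_of_nonneg (fun z _ => mul_self_nonneg (w z))).1 h' z hz
  exact mul_self_eq_zero.1 this

lemma cont_dot {N : ℕ} {G : ℝ → Fin N → ℝ} (hG : Continuous G) (p : Fin N → ℝ) :
    Continuous fun t => dotProduct p (G t) := by
  unfold dotProduct; fun_prop

/-- A nonnegative nonzero polynomial has at most `n` zeros. -/
lemma card_zeros_le {a b s : ℝ} (hab : a < b) (hsb : s ≤ b) {n : ℕ} (hn : 1 ≤ n)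
    {G : ℝ → Fin (2 * n) → ℝ}
    (hG : Continuous G) (H : ChebProp a b G) (p : Fin (2 * n) → ℝ) (hp : p ≠ 0)
    (hpos : ∀ t ∈ Set.Icc a s, 0 ≤ dotProduct p (G t))
    (Z : Finset ℝ) (hZ : ∀ z ∈ Z, z ∈ Set.Icc a s) (hz : ∀ z ∈ Z, dotProduct p (G z) = 0) :
    Z.card ≤ n := by
  by_contra hcon
  push Not at hcon
  obtain ⟨X, hXZ, hX⟩ := Finset.exists_subset_card_eq (Nat.succ_le_of_lt hcon)
  let x := X.orderEmbOfFin hX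
  have hxX : ∀ i, x i ∈ X := fun i => Finset.orderEmbOfFin_mem X hX i
  have hxI : ∀ i, x i ∈ Set.Icc a s := fun i => hZ _ (hXZ (hxX i))
  have hxm : StrictMono x := x.strictMono
  have hy : ∀ i : Fin n, ∃ y ∈ Set.Ioo (x i.castSucc) (x i.succ), 0 < dotProduct p (G y) := by
    intro i
    by_contra hno
    push Not at hno
    apply hp
    have hlt : x i.castSucc < x i.succ := hxm Fin.castSucc_lt_succ
    obtain ⟨W, hW, hWc⟩ := (Set.Ioo_infinite hlt).exists_subset_card_eq (2 * n)
    have hWI : ∀ z ∈ W, z ∈ Set.Icc a s := fun z hz =>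
      ⟨(hxI _).1.trans (hW hz).1.le, (hW hz).2.le.trans (hxI _).2⟩
    refine H p W (fun z hz => ⟨(hWI z hz).1, (hWI z hz).2.trans hsb⟩) hWc.ge ?_
    intro z hz
    exact le_antisymm (hno z (hW hz)) (hpos z (hWI z hz))
  choose y hyI hypos using hy
  obtain ⟨q, hq⟩ := interp hab H X (fun z hz => ⟨(hZ z (hXZ hz)).1, (hZ z (hXZ hz)).2.trans hsb⟩)
    (by omega) (fun _ => 1)
  have hδ : ∃ δ : ℝ, 0 < δ ∧ ∀ i : Fin n, 0 < dotProduct p (G (y i)) - δ * dotProduct q (G (y i)) := by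
    have h1 : ∀ᶠ δ in nhdsWithin (0:ℝ) (Set.Ioi 0), ∀ i : Fin n,
        0 < dotProduct p (G (y i)) - δ * dotProduct q (G (y i)) := by
      rw [Filter.eventually_all]
      intro i
      have : ContinuousAt (fun δ : ℝ => dotProduct p (G (y i)) - δ * dotProduct q (G (y i))) 0 := by
        fun_prop
      exact (this.eventually (lt_mem_nhds (by simpa using hypos i))).filter_mono
        nhdsWithin_le_nhds
    obtain ⟨δ, h2, h3⟩ := (h1.and self_mem_nhdsWithin).exists
    exact ⟨δ, h3, h2⟩
  obtain ⟨δ, hδ0, hδ⟩ := hδ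
  set r := p - δ • q with hr
  have hrv : ∀ t, dotProduct r (G t) = dotProduct p (G t) - δ * dotProduct q (G t) := by
    intro t; simp [hr, sub_dotProduct, smul_dotProduct]
  have hrx : ∀ i, dotProduct r (G (x i)) < 0 := by
    intro i
    rw [hrv, hz _ (hXZ (hxX i)), hq _ (hxX i)]; linarith
  have hry : ∀ i, 0 < dotProduct r (G (y i)) := by
    intro i; rw [hrv]; exact hδ i
  have hrc := cont_dot hG r
  have hu : ∀ i : Fin n, ∃ u ∈ Set.Ioo (x i.castSucc) (y i), dotProduct r (G u) = 0 := by
    intro i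
    exact intermediate_value_Ioo (hyI i).1.le hrc.continuousOn ⟨hrx _, hry i⟩
  have hv : ∀ i : Fin n, ∃ u ∈ Set.Ioo (y i) (x i.succ), dotProduct r (G u) = 0 := by
    intro i
    exact intermediate_value_Ioo' (hyI i).2.le hrc.continuousOn ⟨hrx _, hry i⟩
  choose u huI hu0 using hu
  choose v hvI hv0 using hv
  have hstep : ∀ i j : Fin n, i < j → x i.succ ≤ x j.castSucc := by
    intro i j hij
    exact hxm.monotone (by rw [Fin.le_def]; simpa using hij)
  let e : Fin n ⊕ Fin n → ℝ := Sum.elim u v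
  have heI : ∀ k : Fin n ⊕ Fin n, x (Sum.elim id id k).castSucc < e k ∧
      e k < x (Sum.elim id id k).succ := by
    rintro (i | i)
    · exact ⟨(huI i).1, (huI i).2.trans (hyI i).2⟩
    · exact ⟨(hyI i).1.trans (hvI i).1, (hvI i).2⟩
  have he : Function.Injective e := by
    intro k l hkl
    have h1 := heI k
    have h2 := heI l
    rw [hkl] at h1
    rcases lt_trichotomy (Sum.elim id id k) (Sum.elim id id l) with h | h | h
    · have := hstep _ _ h; linarith
    · rcases k with i | i <;> rcases l with j | j <;> simp at h <;> subst h
      · rfl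
      · have := (huI i).2; have := (hvI i).1; simp [e] at hkl; linarith
      · have := (huI i).2; have := (hvI i).1; simp [e] at hkl; linarith
      · rfl
    · have := hstep _ _ h; linarith
  have hr0 : r = 0 := by
    refine H r (Finset.univ.image e) ?_ ?_ ?_
    · intro z hz
      obtain ⟨k, -, rfl⟩ := Finset.mem_image.1 hz
      exact ⟨(hxI _).1.trans (heI k).1.le, (heI k).2.le.trans ((hxI _).2.trans hsb)⟩
    · rw [Finset.card_image_of_injective _ he]; simp [two_mul]
    · intro z hz
      obtain ⟨k, -, rfl⟩ := Finset.mem_image.1 hz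
      rcases k with i | i
      · exact hu0 i
      · exact hv0 i
  have := hrx 0
  rw [hr0] at this
  simp at this

lemma exists_zero_of_integral {h : ℝ → ℝ} (hh : Continuous h) {s t : ℝ} (hst : s < t)
    (h0 : ∫ u in s..t, h u = 0) : ∃ z ∈ Set.Ioo s t, h z = 0 := by
  have hd : ∀ x, HasDerivAt (fun x => ∫ u in s..x, h u) (h x) x := fun x =>
    (hh.integral_hasStrictDerivAt s x).hasDerivAt
  refine exists_hasDerivAt_eq_zero (f := fun x => ∫ u in s..x, h u) hst
    (fun x _ => (hd x).continuousAt.continuousWithinAt) ?_ (fun x _ => hd x)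
  simp [h0]

/-- A positive measure with density cannot be represented by fewer than `n` nodes. -/
lemma le_card_nodes {a b : ℝ} (hab : a < b) {n : ℕ} 
    {G : ℝ → Fin (2 * n) → ℝ} (hG : Continuous G) (H : ChebProp a b G)
    {ω : ℝ → ℝ} (hω : Continuous ω) (hpos : ∀ x, 0 < ω x)
    (X : Finset ℝ) (hX : ∀ z ∈ X, z ∈ Set.Icc a b)
    (hrep : ∀ p : Fin (2 * n) → ℝ, (∀ z ∈ X, dotProduct p (G z) = 0) →
      ∫ t in a..b, dotProduct p (G t) * ω t = 0) : n ≤ X.card := by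
  by_contra hcon
  push Not at hcon
  obtain ⟨r, hr⟩ : ∃ r, r + X.card = 2 * n := ⟨2 * n - X.card, by omega⟩
  obtain ⟨S, hS1, hS2, hS3⟩ := exists_pad hab (insert a (insert b X)) (by
    intro z hz
    simp only [Finset.mem_insert] at hz
    rcases hz with rfl | rfl | hz
    · exact ⟨le_rfl, hab.le⟩
    · exact ⟨hab.le, le_rfl⟩
    · exact hX z hz) (r + 1) (by
      have h1 := Finset.card_insert_le a (insert b X)
      have h2 := Finset.card_insert_le b X
      omega)
  let s := S.orderEmbOfFin hS3
  have hsm : StrictMono s := s.strictMono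
  have hsS : ∀ i, s i ∈ S := fun i => Finset.orderEmbOfFin_mem S hS3 i
  have hsurj : ∀ z ∈ S, ∃ i, s i = z := by
    intro z hz
    have : z ∈ Set.range s := by rw [Finset.range_orderEmbOfFin]; exact hz
    exact this
  have hs0 : s 0 = a := by
    obtain ⟨i, hi⟩ := hsurj a (hS1 (by simp))
    refine le_antisymm ?_ (hS2 _ (hsS 0)).1
    rw [← hi]; exact hsm.monotone (Fin.zero_le i)
  have hsr : s (Fin.last r) = b := by
    obtain ⟨i, hi⟩ := hsurj b (hS1 (by simp))
    refine le_antisymm (hS2 _ (hsS _)).2 ?_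
    rw [← hi]; exact hsm.monotone (Fin.le_last i)
  have hc : ∀ p : Fin (2 * n) → ℝ, Continuous fun t => dotProduct p (G t) * ω t := fun p =>
    (cont_dot hG p).mul hω
  let T : (Fin (2 * n) → ℝ) →ₗ[ℝ] (Fin r ⊕ X → ℝ) :=
    { toFun := fun p => Sum.elim
        (fun i => ∫ t in (s i.castSucc)..(s i.succ), dotProduct p (G t) * ω t)
        (fun z => dotProduct p (G z))
      map_add' := by
        intro p q; ext z
        rcases z with i | z
        · simp only [Sum.elim_inl, Pi.add_apply, add_dotProduct, add_mul]
          exact intervalIntegral.integral_add ((hc p).intervalIntegrable _ _)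
            ((hc q).intervalIntegrable _ _)
        · simp [add_dotProduct]
      map_smul' := by
        intro c q; ext z
        rcases z with i | z
        · simp [smul_dotProduct, mul_assoc]
        · simp [smul_dotProduct] }
  have hinj : Function.Injective T := by
    rw [← LinearMap.ker_eq_bot, LinearMap.ker_eq_bot']
    intro p hp
    have hz : ∀ i : Fin r, ∃ z ∈ Set.Ioo (s i.castSucc) (s i.succ),
        dotProduct p (G z) = 0 := by
      intro i
      obtain ⟨z, hz, h0⟩ := exists_zero_of_integral (hc p)
        (hsm (Fin.castSucc_lt_succ (i := i))) (congrFun hp (Sum.inl i))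
      exact ⟨z, hz, (mul_eq_zero.1 h0).resolve_right (hpos z).ne'⟩
    choose z hzI hz0 using hz
    have hstep : ∀ i j : Fin r, i < j → s i.succ ≤ s j.castSucc := by
      intro i j hij
      exact hsm.monotone (by rw [Fin.le_def]; simpa using hij)
    have hzinj : Function.Injective z := by
      intro i j hij
      have h1 := hzI i
      have h2 := hzI j
      rw [hij] at h1
      rcases lt_trichotomy i j with h | h | h
      · have := hstep _ _ h; linarith [h1.2, h2.1]
      · exact h
      · have := hstep _ _ h; linarith [h2.2, h1.1]
    have hdisj : Disjoint (Finset.univ.image z) X := by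
      rw [Finset.disjoint_left]
      intro y hy hyX
      obtain ⟨i, -, rfl⟩ := Finset.mem_image.1 hy
      obtain ⟨k, hk⟩ := hsurj _ (hS1 (Finset.mem_insert_of_mem (Finset.mem_insert_of_mem hyX)))
      have h1 := hzI i
      rw [← hk] at h1
      have h2 := hsm.lt_iff_lt.1 h1.1
      have h3 := hsm.lt_iff_lt.1 h1.2
      rw [Fin.lt_def] at h2 h3
      simp at h2 h3
      omega
    refine H p (Finset.univ.image z ∪ X) ?_ ?_ ?_
    · intro y hy
      rcases Finset.mem_union.1 hy with hy | hy
      · obtain ⟨i, -, rfl⟩ := Finset.mem_image.1 hy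
        exact ⟨(hS2 _ (hsS _)).1.trans (hzI i).1.le, (hzI i).2.le.trans (hS2 _ (hsS _)).2⟩
      · exact hX y hy
    · rw [Finset.card_union_of_disjoint hdisj, Finset.card_image_of_injective _ hzinj]
      simp [hr]
    · intro y hy
      rcases Finset.mem_union.1 hy with hy | hy
      · obtain ⟨i, -, rfl⟩ := Finset.mem_image.1 hy
        exact hz0 i
      · exact congrFun hp (Sum.inr ⟨y, hy⟩)
  have hTs : Function.Surjective T := by
    refine (LinearMap.injective_iff_surjective_of_finrank_eq_finrank ?_).1 hinj
    simp [hr]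
  obtain ⟨p, hp⟩ := hTs (Sum.elim (fun _ => 1) (fun _ => 0))
  have h0 := hrep p (fun z hz => congrFun hp (Sum.inr ⟨z, hz⟩))
  have h1 : ∀ i : Fin r, ∫ t in (s i.castSucc)..(s i.succ), dotProduct p (G t) * ω t = 1 :=
    fun i => congrFun hp (Sum.inl i)
  let s' : ℕ → ℝ := fun k => if h : k < r + 1 then s ⟨k, h⟩ else b
  have h2 := intervalIntegral.sum_integral_adjacent_intervals (μ := volume) (a := s') (n := r)
    (f := fun t => dotProduct p (G t) * ω t) (fun k _ => (hc p).intervalIntegrable _ _)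
  have e0 : s' 0 = a := by rw [← hs0]; simp [s']
  have er : s' r = b := by rw [← hsr]; simp [s']; rfl
  rw [e0, er, h0, ← Fin.sum_univ_eq_sum_range
    (fun k => ∫ t in (s' k)..(s' (k+1)), dotProduct p (G t) * ω t)] at h2
  have h3 : ∀ i : Fin r, ∫ t in (s' i)..(s' (i+1)), dotProduct p (G t) * ω t = 1 := by
    intro i
    rw [← h1 i]
    have ea : s' i = s i.castSucc := by
      simp only [s']; rw [dif_pos (by omega)]; rfl
    have eb : s' (i+1) = s i.succ := by
      simp only [s']; rw [dif_pos (by omega)]; rfl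
    rw [ea, eb]
  simp only [h3] at h2
  simp at h2
  omega

lemma compact_hull {a s : ℝ} (has : a ≤ s) {N : ℕ} {G : ℝ → Fin N → ℝ} (hG : Continuous G) :
    IsCompact (convexHull ℝ (G '' Set.Icc a s)) := by
  let Φ : (Fin (N + 1) → ℝ) × (Fin (N + 1) → ℝ) → (Fin N → ℝ) :=
    fun q => ∑ i, q.1 i • G (q.2 i)
  have hΦ : Continuous Φ := by
    simp only [Φ]; fun_prop
  have hK : IsCompact (stdSimplex ℝ (Fin (N + 1)) ×ˢ
      (Set.univ.pi fun _ : Fin (N + 1) => Set.Icc a s)) :=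
    (isCompact_stdSimplex ℝ _).prod (isCompact_univ_pi fun _ => isCompact_Icc)
  convert hK.image hΦ using 1
  apply Set.Subset.antisymm
  · intro c hc
    obtain ⟨ι, hι, z, w, hz, hai, hw, hw1, hwc⟩ := eq_pos_convex_span_of_mem_convexHull hc
    have hcard : Fintype.card ι ≤ N + 1 := by
      have h1 := hai.card_le_finrank_succ
      have h2 := Submodule.finrank_le (vectorSpan ℝ (Set.range z))
      simp only [Module.finrank_fin_fun] at h2
      omega
    obtain ⟨e⟩ : Nonempty (ι ↪ Fin (N + 1)) :=
      Function.Embedding.nonempty_of_card_le (by simpa using hcard)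
    have : ∀ i, ∃ x ∈ Set.Icc a s, G x = z i := fun i => hz ⟨i, rfl⟩
    choose x hx hxz using this
    refine ⟨(Function.extend e w 0, Function.extend e x fun _ => a), ⟨⟨?_, ?_⟩, ?_⟩, ?_⟩
    · intro i
      by_cases h : ∃ j, e j = i
      · obtain ⟨j, rfl⟩ := h
        simp [e.injective.extend_apply, (hw j).le]
      · simp [Function.extend_apply' _ _ _ h]
    · rw [← hw1]
      symm
      refine Fintype.sum_of_injective e e.injective _ _ ?_ ?_
      · intro i hi; simp [Function.extend_apply' _ _ _ hi]
      · intro j; simp [e.injective.extend_apply]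
    · intro i _
      by_cases h : ∃ j, e j = i
      · obtain ⟨j, rfl⟩ := h
        simpa [e.injective.extend_apply] using hx j
      · simpa [Function.extend_apply' _ _ _ h] using has
    · rw [← hwc]
      symm
      refine Fintype.sum_of_injective e e.injective _ _ ?_ ?_
      · intro i hi; simp [Function.extend_apply' _ _ _ hi]
      · intro j; simp [e.injective.extend_apply, hxz]
  · rintro _ ⟨⟨w, x⟩, ⟨⟨hw0, hw1⟩, hx⟩, rfl⟩
    refine (convex_convexHull ℝ _).sum_mem (fun i _ => hw0 i) hw1 ?_
    intro i _
    exact subset_convexHull ℝ _ ⟨x i, hx i trivial, rfl⟩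

/-- Nonnegative polynomials on `[a,s]` with nonpositive moment, maximal `s`. -/
lemma exists_max_s {a b : ℝ} (hab : a < b) {n : ℕ} (hn : 1 ≤ n)
    {G : ℝ → Fin (2 * n) → ℝ} (hG : Continuous G) (H : ChebProp a b G) (c : Fin (2 * n) → ℝ)
    (hc : ∀ p : Fin (2 * n) → ℝ, p ≠ 0 → (∀ t ∈ Set.Icc a b, 0 ≤ dotProduct p (G t)) →
      0 < dotProduct p c) :
    ∃ s, a ≤ s ∧ s ≤ b ∧
      (∃ p : Fin (2 * n) → ℝ, p ≠ 0 ∧ (∀ t ∈ Set.Icc a s, 0 ≤ dotProduct p (G t)) ∧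
        dotProduct p c ≤ 0) ∧
      ¬ (∃ p : Fin (2 * n) → ℝ, (∀ t ∈ Set.Icc a s, 0 < dotProduct p (G t)) ∧
        dotProduct p c ≤ 0) := by
  let A : Set (ℝ × (Fin (2 * n) → ℝ)) :=
    (Set.Icc a b ×ˢ Metric.sphere 0 1) ∩
      ({q | ∀ t ∈ Set.Icc a b, 0 ≤ dotProduct q.2 (G (min t q.1))} ∩ {q | dotProduct q.2 c ≤ 0})
  have hA : IsCompact A := by
    refine (isCompact_Icc.prod (isCompact_sphere 0 1)).inter_right (IsClosed.inter ?_ ?_)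
    · simp only [Set.setOf_forall]
      refine isClosed_iInter fun t => isClosed_iInter fun _ => ?_
      refine isClosed_le continuous_const ?_
      unfold dotProduct; fun_prop
    · refine isClosed_le ?_ continuous_const
      unfold dotProduct; fun_prop
  have hmem : ∀ s ∈ Set.Icc a b, ∀ p : Fin (2 * n) → ℝ, p ≠ 0 →
      (∀ t ∈ Set.Icc a s, 0 ≤ dotProduct p (G t)) → dotProduct p c ≤ 0 →
      s ∈ Prod.fst '' A := by
    intro s hs p hp h1 h2
    have hpn : 0 < ‖p‖ := norm_pos_iff.2 hp
    refine ⟨(s, ‖p‖⁻¹ • p), ⟨⟨hs, ?_⟩, ?_, ?_⟩, rfl⟩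
    · simp [norm_smul, hpn.ne']
    · intro t ht
      simp only [smul_dotProduct, smul_eq_mul]
      exact mul_nonneg (inv_nonneg.2 hpn.le) (h1 _ ⟨le_min ht.1 hs.1, min_le_right _ _⟩)
    · simp only [Set.mem_setOf_eq, smul_dotProduct, smul_eq_mul]
      exact mul_nonpos_of_nonneg_of_nonpos (inv_nonneg.2 hpn.le) h2
  have hne : (Prod.fst '' A).Nonempty := by
    obtain ⟨q, hq⟩ := interp hab H {a, b} (by simp [hab.le])
      (by rw [Finset.card_pair hab.ne]; omega) (fun t => t - a)
    have hqa : dotProduct q (G a) = 0 := by simpa using hq a (by simp)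
    have hqb : dotProduct q (G b) = b - a := by simpa using hq b (by simp)
    have hq0 : q ≠ 0 := by
      rintro rfl
      simp at hqb; linarith
    rcases le_total (dotProduct q c) 0 with h | h
    · refine ⟨a, hmem a ⟨le_rfl, hab.le⟩ q hq0 ?_ h⟩
      intro t ht
      have : t = a := le_antisymm ht.2 ht.1
      rw [this, hqa]
    · refine ⟨a, hmem a ⟨le_rfl, hab.le⟩ (-q) (neg_ne_zero.2 hq0) ?_ (by simpa using h)⟩
      intro t ht
      have : t = a := le_antisymm ht.2 ht.1
      rw [this, neg_dotProduct, hqa, neg_zero]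
  obtain ⟨s, ⟨⟨⟨s', p⟩, ⟨⟨hs, hp1⟩, hp2, hp3⟩, rfl⟩, hmax⟩⟩ :=
    (hA.image continuous_fst).exists_isGreatest hne
  simp only at hs hp1 hp2 hp3 hmax ⊢
  have hpz : p ≠ 0 := by rintro rfl; simp at hp1
  have hpn : ∀ t ∈ Set.Icc a s', 0 ≤ dotProduct p (G t) := by
    intro t ht
    have := hp2 t ⟨ht.1, ht.2.trans hs.2⟩
    rwa [min_eq_left ht.2] at this
  refine ⟨s', hs.1, hs.2, ⟨p, hpz, hpn, hp3⟩, ?_⟩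
  rintro ⟨q, hq1, hq2⟩
  have hq0 : q ≠ 0 := by
    rintro rfl
    have := hq1 a ⟨le_rfl, hs.1⟩
    simp at this
  rcases hs.2.eq_or_lt with h | h
  · have := hc q hq0 (fun t ht => (hq1 t (by rwa [h])).le)
    linarith
  · have hev : ∀ᶠ t in nhdsWithin s' (Set.Ioi s'), 0 < dotProduct q (G t) :=
      ((cont_dot hG q).continuousAt.eventually (lt_mem_nhds (hq1 s' ⟨hs.1, le_rfl⟩))).filter_mono
        nhdsWithin_le_nhds
    obtain ⟨u, hu, hu'⟩ := (mem_nhdsGT_iff_exists_Ioc_subset).1 hev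
    have hu : s' < u := hu
    have hb : min u b ∈ Prod.fst '' A := by
      refine hmem _ ⟨le_min (hs.1.trans hu.le) hab.le, min_le_right _ _⟩ q hq0 ?_ hq2
      intro t ht
      rcases le_or_gt t s' with h' | h'
      · exact (hq1 t ⟨ht.1, h'⟩).le
      · exact (hu' ⟨h', ht.2.trans (min_le_left _ _)⟩ : 0 < dotProduct q (G t)).le
    have := hmax hb
    have := lt_min hu h
    linarith

lemma functional_eq {N : ℕ} (f : StrongDual ℝ (Fin N → ℝ)) :
    ∃ p : Fin N → ℝ, ∀ x, f x = dotProduct p x := by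
  refine ⟨fun j => f (Pi.single j 1), fun x => ?_⟩
  conv_lhs => rw [pi_eq_sum_univ' x]
  simp [dotProduct, mul_comm]

/-- Representation of a hull point by distinct nodes. -/
lemma hull_nodes {a s : ℝ} {N : ℕ} {G : ℝ → Fin N → ℝ} {c : Fin N → ℝ}
    (hc : c ∈ convexHull ℝ (G '' Set.Icc a s)) :
    ∃ (X : Finset ℝ) (w : ℝ → ℝ), (∀ x ∈ X, x ∈ Set.Icc a s) ∧ (∀ x ∈ X, 0 < w x) ∧
      X.Nonempty ∧ ∑ x ∈ X, w x • G x = c := by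
  obtain ⟨ι, hι, z, w, hz, hai, hw, hw1, hwc⟩ := eq_pos_convex_span_of_mem_convexHull hc
  have : ∀ i, ∃ x ∈ Set.Icc a s, G x = z i := fun i => hz ⟨i, rfl⟩
  choose x hx hxz using this
  have hinj : Function.Injective x := by
    intro i j hij
    apply hai.injective
    rw [← hxz, ← hxz, hij]
  classical
  refine ⟨Finset.univ.image x, Function.extend x w 0, ?_, ?_, ?_, ?_⟩
  · intro y hy
    obtain ⟨i, -, rfl⟩ := Finset.mem_image.1 hy
    exact hx i
  · intro y hy
    obtain ⟨i, -, rfl⟩ := Finset.mem_image.1 hy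
    rw [hinj.extend_apply]; exact hw i
  · have : Nonempty ι := by
      by_contra h
      rw [not_nonempty_iff] at h
      simp at hw1
    simpa using Finset.univ_nonempty
  · rw [Finset.sum_image (fun _ _ _ _ h => hinj h), ← hwc]
    refine Finset.sum_congr rfl fun i _ => ?_
    rw [hinj.extend_apply, hxz]

lemma core {a b : ℝ} (hab : a < b) {n : ℕ} (hn : 1 ≤ n)
    {G : ℝ → Fin (2 * n) → ℝ} (hG : Continuous G) (H : ChebProp a b G)
    {ω : ℝ → ℝ} (hω : Continuous ω) (hpos : ∀ x, 0 < ω x) :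
    ∃ (X : Finset ℝ) (w : ℝ → ℝ), (∀ x ∈ X, x ∈ Set.Icc a b) ∧ (∀ x ∈ X, 0 < w x) ∧
      X.card = n ∧ ∀ j, ∫ t in a..b, G t j * ω t = ∑ x ∈ X, w x * G x j := by
  set c : Fin (2 * n) → ℝ := fun j => ∫ t in a..b, G t j * ω t with hcdef
  have hpc : ∀ p : Fin (2 * n) → ℝ,
      dotProduct p c = ∫ t in a..b, dotProduct p (G t) * ω t := by
    intro p
    simp only [dotProduct, Finset.sum_mul, hcdef]
    rw [intervalIntegral.integral_finsetSum]
    · refine Finset.sum_congr rfl fun j _ => ?_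
      rw [← intervalIntegral.integral_const_mul]
      simp only [mul_assoc]
    · intro j _
      apply Continuous.intervalIntegrable
      fun_prop
  have hcpos : ∀ p : Fin (2 * n) → ℝ, p ≠ 0 →
      (∀ t ∈ Set.Icc a b, 0 ≤ dotProduct p (G t)) → 0 < dotProduct p c := by
    intro p hp h
    rw [hpc]
    refine intervalIntegral.integral_pos hab ((cont_dot hG p).mul hω).continuousOn
      (fun x hx => mul_nonneg (h x ⟨hx.1.le, hx.2⟩) (hpos x).le) ?_
    by_contra hno
    push Not at hno
    apply hp
    obtain ⟨W, hW, hWc⟩ := (Set.Icc_infinite hab).exists_subset_card_eq (2 * n)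
    refine H p W (fun z hz => hW hz) hWc.ge fun z hz => ?_
    have h1 := hno z (hW hz)
    have h2 := h z (hW hz)
    have h3 := hpos z
    by_contra hne
    have := mul_pos (lt_of_le_of_ne h2 (Ne.symm hne)) h3
    linarith
  obtain ⟨s, has, hsb, ⟨p, hp0, hpn, hpc0⟩, hnot⟩ := exists_max_s hab hn hG H c hcpos
  have hsub : ∀ X : Finset ℝ, (∀ x ∈ X, x ∈ Set.Icc a s) → ∀ x ∈ X, x ∈ Set.Icc a b :=
    fun X h x hx => ⟨(h x hx).1, (h x hx).2.trans hsb⟩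
  -- any positive combination with nonpositive `p`-value is supported on zeros of `p`
  have hzero : ∀ (X : Finset ℝ) (w : ℝ → ℝ), (∀ x ∈ X, x ∈ Set.Icc a s) →
      (∀ x ∈ X, 0 < w x) → dotProduct p (∑ x ∈ X, w x • G x) ≤ 0 → X.card ≤ n := by
    intro X w hX hw hle
    refine card_zeros_le hab hsb hn hG H p hp0 hpn X hX fun x hx => ?_
    rw [dotProduct_sum] at hle
    simp only [dotProduct_smul, smul_eq_mul] at hle
    have hnn : ∀ x ∈ X, 0 ≤ w x * dotProduct p (G x) := fun x hx =>
      mul_nonneg (hw x hx).le (hpn x (hX x hx))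
    have h0 := (Finset.sum_eq_zero_iff_of_nonneg hnn).1 (le_antisymm hle (Finset.sum_nonneg hnn))
      x hx
    exact (mul_eq_zero.1 h0).resolve_left (hw x hx).ne'
  have h0C : (0 : Fin (2 * n) → ℝ) ∉ convexHull ℝ (G '' Set.Icc a s) := by
    intro h
    obtain ⟨X, w, hX, hw, ⟨x, hx⟩, hsum⟩ := hull_nodes h
    have hcard := hzero X w hX hw (by rw [hsum]; simp)
    have := indep hab H X (hsub X hX) (by omega) w hsum x hx
    exact (hw x hx).ne' this
  have hray : ∃ l : ℝ, 0 < l ∧ l • c ∈ convexHull ℝ (G '' Set.Icc a s) := by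
    by_contra hno
    push Not at hno
    have hc0 : c ≠ 0 := by
      intro h
      obtain ⟨q, hq⟩ : ∃ q : Fin (2 * n) → ℝ, ∀ x, ∀ t ∈ Set.Icc a s, 
          (x = dotProduct q (G t)) → 0 < dotProduct q (G t) := by
        obtain ⟨f, u, v, hf, huv, hv⟩ := geometric_hahn_banach_compact_closed
          (convex_singleton (0 : Fin (2 * n) → ℝ)) isCompact_singleton
          (convex_convexHull ℝ (G '' Set.Icc a s)) (compact_hull has hG).isClosed
          (Set.disjoint_singleton_left.2 h0C)
        obtain ⟨q, hq⟩ := functional_eq f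
        refine ⟨q, fun x t ht _ => ?_⟩
        have h1 := hf 0 rfl
        have h2 := hv (G t) (subset_convexHull ℝ _ ⟨t, ht, rfl⟩)
        rw [hq] at h1 h2
        simp at h1
        linarith
      exact hnot ⟨q, fun t ht => hq _ t ht rfl, by simp [h]⟩
    let R : Set (Fin (2 * n) → ℝ) := (fun l : ℝ => l • c) '' Set.Ici 0
    have hRconv : Convex ℝ R :=
      (convex_Ici (0 : ℝ)).is_linear_image (f := fun l : ℝ => l • c)
        ⟨fun x y => add_smul x y c, fun x y => by simp [mul_smul]⟩
    have hRcl : IsClosed R :=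
      (isClosedEmbedding_smul_left hc0).isClosedMap _ isClosed_Ici
    have hdis : Disjoint R (convexHull ℝ (G '' Set.Icc a s)) := by
      rw [Set.disjoint_left]
      rintro _ ⟨l, hl, rfl⟩ hm
      rcases (Set.mem_Ici.1 hl).eq_or_lt with h | h
      · subst h
        apply h0C
        simpa using hm
      · exact hno l h hm
    obtain ⟨f, u, v, hf, huv, hv⟩ := geometric_hahn_banach_closed_compact
      hRconv hRcl (convex_convexHull ℝ (G '' Set.Icc a s)) (compact_hull has hG) hdis
    obtain ⟨q, hq⟩ := functional_eq f
    have hu0 : 0 < u := by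
      have := hf ((0:ℝ) • c) ⟨0, by simp, rfl⟩
      simpa using this
    refine hnot ⟨q, fun t ht => ?_, ?_⟩
    · have h2 := hv (G t) (subset_convexHull ℝ _ ⟨t, ht, rfl⟩)
      rw [hq] at h2
      linarith
    · by_contra hgt
      push Not at hgt
      have := hf ((u / dotProduct q c) • c) ⟨_, Set.mem_Ici.2 (by positivity), rfl⟩
      rw [hq, dotProduct_smul, smul_eq_mul, div_mul_cancel₀ _ hgt.ne'] at this
      exact lt_irrefl _ this
  obtain ⟨l, hl, hlc⟩ := hray
  obtain ⟨X, w, hX, hw, hXne, hsum⟩ := hull_nodes hlc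
  have hup : X.card ≤ n := by
    refine hzero X w hX hw ?_
    rw [hsum, dotProduct_smul, smul_eq_mul]
    exact mul_nonpos_of_nonneg_of_nonpos hl.le hpc0
  have hlo : n ≤ X.card := by
    refine le_card_nodes hab hG H hω hpos X (hsub X hX) fun q hq => ?_
    rw [← hpc]
    have h1 : dotProduct q (l • c) = 0 := by
      rw [← hsum, dotProduct_sum]
      refine Finset.sum_eq_zero fun x hx => ?_
      rw [dotProduct_smul, hq x hx, smul_zero]
    rw [dotProduct_smul, smul_eq_mul] at h1
    exact (mul_eq_zero.1 h1).resolve_left hl.ne'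
  refine ⟨X, fun x => l⁻¹ * w x, hsub X hX, fun x hx => mul_pos (inv_pos.2 hl) (hw x hx),
    le_antisymm hup hlo, fun j => ?_⟩
  have h1 := congrFun hsum j
  simp only [Finset.sum_apply, Pi.smul_apply, smul_eq_mul] at h1
  change c j = _
  simp only [mul_assoc]
  rw [← Finset.mul_sum, h1]
  field_simp

theorem exists_generalised_gauss_quadrature
    (n : ℕ) (hn : 1 ≤ n) (a b : ℝ) (hab : a < b)
    (g : Fin (2 * n) → ℝ → ℝ)
    (hg : ∀ j, ContinuousOn (g j) (Set.Icc a b))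
    (hT : IsTchebyshevSystem a b g)
    (ω : ℝ → ℝ) (hω : ContinuousOn ω (Set.Icc a b))
    (hωpos : ∀ x ∈ Set.Icc a b, 0 < ω x) :
    ∃ (x w : Fin n → ℝ), StrictMono x ∧ (∀ k, x k ∈ Set.Icc a b) ∧
      (∀ k, 0 < w k) ∧
      ∀ j, ∫ t in a..b, g j t * ω t = ∑ k, w k * g j (x k) := by
  let π : ℝ → ℝ := fun t => Set.projIcc a b hab.le t
  have hπc : Continuous π := continuous_subtype_val.comp continuous_projIcc
  have hπm : ∀ t, π t ∈ Set.Icc a b := fun t => (Set.projIcc a b hab.le t).2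
  have hπe : ∀ t ∈ Set.Icc a b, π t = t := fun t ht => by
    simp only [π]; rw [Set.projIcc_of_mem hab.le ht]
  let G : ℝ → Fin (2 * n) → ℝ := fun t j => g j (π t)
  have hG : Continuous G := continuous_pi fun j => (hg j).comp_continuous hπc hπm
  have hω' : Continuous fun t => ω (π t) := hω.comp_continuous hπc hπm
  have H : ChebProp a b G := by
    intro p Z hZ hcard hz
    obtain ⟨Y, hYZ, hY⟩ := Finset.exists_subset_card_eq hcard
    have hm : ∀ i, Y.orderEmbOfFin hY i ∈ Z := fun i => hYZ (Finset.orderEmbOfFin_mem Y hY i)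
    refine Matrix.eq_zero_of_mulVec_eq_zero
      (hT (Y.orderEmbOfFin hY) (Y.orderEmbOfFin hY).strictMono fun i => hZ _ (hm i)) ?_
    ext i
    have h := hz _ (hm i)
    simp only [G, hπe _ (hZ _ (hm i))] at h
    rw [dotProduct_comm] at h
    exact h
  obtain ⟨X, w, hX, hw, hc, hj⟩ := core hab hn hG H hω' fun x => hωpos _ (hπm x)
  let x := X.orderEmbOfFin hc
  have hxX : ∀ i, x i ∈ X := fun i => Finset.orderEmbOfFin_mem X hc i
  refine ⟨x, fun k => w (x k), x.strictMono, fun k => hX _ (hxX k), fun k => hw _ (hxX k),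
    fun j => ?_⟩
  have h1 : ∫ t in a..b, g j t * ω t = ∫ t in a..b, G t j * ω (π t) := by
    refine intervalIntegral.integral_congr fun t ht => ?_
    rw [Set.uIcc_of_le hab.le] at ht
    simp only [G, hπe t ht]
  rw [h1, hj j]
  have himg : X = Finset.univ.image x := by
    ext y
    have : y ∈ X ↔ y ∈ Set.range x := by rw [Finset.range_orderEmbOfFin]; rfl
    rw [this]; simp
  have h2 : ∑ y ∈ X, w y * G y j = ∑ y ∈ Finset.univ.image x, w y * G y j := by rw [← himg]
  rw [h2, Finset.sum_image (fun _ _ _ _ h => x.injective h)]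
  refine Finset.sum_congr rfl fun k _ => ?_
  simp only [G, hπe _ (hX _ (hxX k))]
end

section
/- Let n ≥ 1, let a < b, let g_1, …, g_{2n} be continuous real-valued functions forming a Tchebyshev system on [a,b], and let ω be a continuous, strictly positive weight function on [a,b]. Then there exist nodes a = x_0 < x_1 < … < x_n = b and strictly positive weights w_0, …, w_n such that ∫_a^b g_j(x)ω(x) dx = Σ_{k=0}^n w_k g_j(x_k) for every j = 1, …, 2n (i.e., a closed (n+1)-point generalised Gauss–Lobatto quadrature rule exact for g_1, …, g_{2n} with positive weights exists). -/
open MeasureTheory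

namespace GLob

/-- generalized polynomial with coefficients `c` -/
noncomputable def P {N : ℕ} (g : Fin N → ℝ → ℝ) (c : Fin N → ℝ) (t : ℝ) : ℝ := ∑ j, c j * g j t

variable {N : ℕ} {g : Fin N → ℝ → ℝ} {a b : ℝ}

lemma P_add (c d : Fin N → ℝ) (t : ℝ) : P g (c + d) t = P g c t + P g d t := by
  simp [P, add_mul, Finset.sum_add_distrib]

lemma P_smul (r : ℝ) (d : Fin N → ℝ) (t : ℝ) : P g (r • d) t = r * P g d t := by
  simp [P, Finset.mul_sum, mul_assoc]

lemma P_sub (c d : Fin N → ℝ) (t : ℝ) : P g (c - d) t = P g c t - P g d t := by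
  simp [P, sub_mul, Finset.sum_sub_distrib]

lemma P_zero (t : ℝ) : P g 0 t = 0 := by simp [P]

lemma P_sum {ι : Type*} (s : Finset ι) (d : ι → Fin N → ℝ) (t : ℝ) :
    P g (∑ i ∈ s, d i) t = ∑ i ∈ s, P g (d i) t := by
  simp only [P, Finset.sum_apply, Finset.sum_mul]
  rw [Finset.sum_comm]

lemma P_cont (hg : ∀ j, ContinuousOn (g j) (Set.Icc a b)) (c : Fin N → ℝ) :
    ContinuousOn (P g c) (Set.Icc a b) := by
  unfold P
  exact continuousOn_finsetSum _ fun j _ => continuousOn_const.mul (hg j)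

lemma P_cont_coef (t : ℝ) : Continuous fun c : Fin N → ℝ => P g c t := by
  unfold P; fun_prop

lemma P_mulVec (c : Fin N → ℝ) (y : Fin N → ℝ) :
    (Matrix.of fun i j => g j (y i)).mulVec c = fun i => P g c (y i) := by
  ext i
  simp [Matrix.mulVec, dotProduct, P, mul_comm]

lemma zero_of_strictMono (hT : IsTchebyshevSystem a b g) (y : Fin N → ℝ) (hy : StrictMono y)
    (hyI : ∀ i, y i ∈ Set.Icc a b) (c : Fin N → ℝ) (h : ∀ i, P g c (y i) = 0) : c = 0 := by
  apply Matrix.eq_zero_of_mulVec_eq_zero (hT y hy hyI)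
  rw [P_mulVec]; ext i; exact h i

lemma zero_of_card (hT : IsTchebyshevSystem a b g) (s : Finset ℝ) (hs : ↑s ⊆ Set.Icc a b)
    (hc : s.card = N) (c : Fin N → ℝ) (h : ∀ t ∈ s, P g c t = 0) : c = 0 :=
  zero_of_strictMono hT (s.orderEmbOfFin hc) (s.orderEmbOfFin hc).strictMono
    (fun i => hs (s.orderEmbOfFin_mem hc i)) c (fun i => h _ (s.orderEmbOfFin_mem hc i))

lemma extend {S : Set ℝ} (hS : S.Infinite) (s : Finset ℝ) (hs : ↑s ⊆ S) (k : ℕ) (hk : s.card ≤ k) :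
    ∃ t : Finset ℝ, s ⊆ t ∧ ↑t ⊆ S ∧ t.card = k := by
  obtain ⟨u, hu, huc⟩ := (hS.sdiff s.finite_toSet).exists_subset_card_eq (k - s.card)
  refine ⟨s ∪ u, Finset.subset_union_left, ?_, ?_⟩
  · rw [Finset.coe_union]
    exact Set.union_subset hs (hu.trans Set.sdiff_subset)
  · rw [Finset.card_union_of_disjoint]
    · omega
    · rw [Finset.disjoint_left]
      intro x hx hxu
      exact (hu hxu).2 hx

lemma interp (hab : a < b) (hT : IsTchebyshevSystem a b g) (s : Finset ℝ) (hs : ↑s ⊆ Set.Icc a b)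
    (hc : s.card ≤ N) (v : ℝ → ℝ) : ∃ c : Fin N → ℝ, ∀ t ∈ s, P g c t = v t := by
  obtain ⟨t, hst, ht, htc⟩ := extend (Set.Icc_infinite hab) s hs N hc
  have hd := hT (t.orderEmbOfFin htc) (t.orderEmbOfFin htc).strictMono
    (fun i => ht (t.orderEmbOfFin_mem htc i))
  have hu : IsUnit (Matrix.of fun i j => g j (t.orderEmbOfFin htc i)) := by
    rw [Matrix.isUnit_iff_isUnit_det]; exact isUnit_iff_ne_zero.2 hd
  obtain ⟨c, hcc⟩ := (Matrix.mulVec_surjective_iff_isUnit.2 hu) (fun i => v (t.orderEmbOfFin htc i))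
  refine ⟨c, fun x hx => ?_⟩
  have : x ∈ Set.range (t.orderEmbOfFin htc) := by
    rw [Finset.range_orderEmbOfFin]; exact hst hx
  obtain ⟨i, rfl⟩ := this
  rw [P_mulVec] at hcc
  exact congrFun hcc i

lemma zeros (hT : IsTchebyshevSystem a b g) (c : Fin N → ℝ) (h0 : c ≠ 0) :
    ∃ Z : Finset ℝ, (∀ t, t ∈ Z ↔ t ∈ Set.Icc a b ∧ P g c t = 0) ∧ Z.card ≤ N := by
  have hfin : {t | t ∈ Set.Icc a b ∧ P g c t = 0}.Finite := by
    by_contra hinf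
    obtain ⟨s, hs, hsc⟩ := Set.Infinite.exists_subset_card_eq hinf N
    exact h0 (zero_of_card hT s (fun t ht => (hs ht).1) hsc c (fun t ht => (hs ht).2))
  refine ⟨hfin.toFinset, by simp, ?_⟩
  by_contra hlt
  push Not at hlt
  obtain ⟨s, hs, hsc⟩ := Finset.exists_subset_card_eq hlt.le
  have hs' : ∀ t ∈ s, t ∈ Set.Icc a b ∧ P g c t = 0 := fun t ht => by simpa using hs ht
  exact h0 (zero_of_card hT s (fun t ht => (hs' t ht).1) hsc c (fun t ht => (hs' t ht).2))

lemma alt (hg : ∀ j, ContinuousOn (g j) (Set.Icc a b)) (hT : IsTchebyshevSystem a b g)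
    (y : ℕ → ℝ) (hy : ∀ i < N, y i < y (i + 1)) (hyI : ∀ i ≤ N, y i ∈ Set.Icc a b)
    (c : Fin N → ℝ) (hN : 0 < N) (h : ∀ i < N, P g c (y i) * P g c (y (i + 1)) < 0) : False := by
  have hz : ∀ i : Fin N, ∃ x, y i < x ∧ x < y (i + 1) ∧ P g c x = 0 := by
    intro i
    have hi := i.2
    have hlt := hy i hi
    have hco : ContinuousOn (P g c) (Set.Icc (y i) (y (i + 1))) :=
      (P_cont hg c).mono (Set.Icc_subset_Icc (hyI i hi.le).1 (hyI (i + 1) hi).2)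
    rcases mul_neg_iff.1 (h i hi) with ⟨h1, h2⟩ | ⟨h1, h2⟩
    · obtain ⟨x, hx, hx0⟩ := intermediate_value_Ioo' hlt.le hco ⟨h2, h1⟩
      exact ⟨x, hx.1, hx.2, hx0⟩
    · obtain ⟨x, hx, hx0⟩ := intermediate_value_Ioo hlt.le hco ⟨h1, h2⟩
      exact ⟨x, hx.1, hx.2, hx0⟩
  choose x hx1 hx2 hx0 using hz
  have hmono : ∀ i j : ℕ, i ≤ j → j ≤ N → y i ≤ y j := by
    intro i j hij
    induction j, hij using Nat.le_induction with
    | base => intro _; exact le_rfl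
    | succ k hk ih => intro hkN; exact (ih (by omega)).trans (hy k (by omega)).le
  have hc0 : c = 0 := by
    refine zero_of_strictMono hT x ?_ ?_ c hx0
    · intro i j hij
      have := hmono (i + 1) j (by exact hij) j.2.le
      linarith [hx2 i, hx1 j]
    · intro i
      exact ⟨(hyI i i.2.le).1.trans (hx1 i).le, (hx2 i).le.trans (hyI (i + 1) i.2).2⟩
  have := h 0 hN
  simp [hc0, P_zero] at this

open Filter Topology in
lemma alt_nonneg (hab : a < b) (hg : ∀ j, ContinuousOn (g j) (Set.Icc a b))
    (hT : IsTchebyshevSystem a b g)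
    (y : ℕ → ℝ) (hy : ∀ i < N, y i < y (i + 1)) (hyI : ∀ i ≤ N, y i ∈ Set.Icc a b)
    (c : Fin N → ℝ) (hN : 0 < N) (hc : c ≠ 0)
    (h : ∀ i < N, P g c (y i) = 0 ∧ 0 < P g c (y (i + 1)) ∨
      0 < P g c (y i) ∧ P g c (y (i + 1)) = 0) : False := by
  obtain ⟨Z, hZ, hZc⟩ := zeros hT c hc
  obtain ⟨q, hq⟩ := interp hab hT Z (fun t ht => ((hZ t).1 ht).1) hZc (fun _ => 1)
  have hev : ∀ᶠ δ : ℝ in 𝓝[>] 0, ∀ i ∈ Finset.range (N + 1), 0 < P g c (y i) →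
      0 < P g c (y i) - δ * P g q (y i) := by
    rw [Filter.eventually_all_finset]
    intro i _
    by_cases hp : 0 < P g c (y i)
    · have : Tendsto (fun δ : ℝ => P g c (y i) - δ * P g q (y i)) (𝓝[>] 0) (𝓝 (P g c (y i))) := by
        have : Continuous (fun δ : ℝ => P g c (y i) - δ * P g q (y i)) := by fun_prop
        have h2 := this.tendsto 0
        simp only [zero_mul, sub_zero] at h2
        exact h2.mono_left nhdsWithin_le_nhds
      filter_upwards [this.eventually_const_lt hp] with δ hδ _ using hδ
    · exact Eventually.of_forall fun _ h => absurd h hp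
  obtain ⟨δ, hδ, hδ0⟩ := (hev.and self_mem_nhdsWithin).exists
  have hδ0 : 0 < δ := hδ0
  have key : ∀ i ≤ N, P g (c - δ • q) (y i) = P g c (y i) - δ * P g q (y i) := by
    intro i _; rw [P_sub, P_smul]
  have hpos : ∀ i ≤ N, 0 < P g c (y i) → 0 < P g (c - δ • q) (y i) := by
    intro i hi hp; rw [key i hi]; exact hδ i (by simp; omega) hp
  have hneg : ∀ i ≤ N, P g c (y i) = 0 → P g (c - δ • q) (y i) < 0 := by
    intro i hi hp; rw [key i hi, hp, hq (y i) ((hZ _).2 ⟨hyI i hi, hp⟩)]; linarith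
  refine alt hg hT y hy hyI (c - δ • q) hN ?_
  intro i hi
  rcases h i hi with ⟨h1, h2⟩ | ⟨h1, h2⟩
  · exact mul_neg_of_neg_of_pos (hneg i hi.le h1) (hpos _ hi h2)
  · exact mul_neg_of_pos_of_neg (hpos i hi.le h1) (hneg _ hi h2)

/-- Perturbation lemma. -/
lemma perturb (hg : ∀ j, ContinuousOn (g j) (Set.Icc a b)) (c q : Fin N → ℝ)
    (hc : ∀ t ∈ Set.Icc a b, 0 ≤ P g c t)
    (hq : ∀ t ∈ Set.Icc a b, P g c t = 0 → 0 < P g q t) :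
    ∃ δ : ℝ, δ > 0 ∧ ∀ t ∈ Set.Icc a b, 0 < P g (c + δ • q) t := by
  have hcomp : IsCompact (Set.Icc a b ∩ P g q ⁻¹' Set.Iic 0) :=
    isCompact_Icc.of_isClosed_subset
      ((P_cont hg q).preimage_isClosed_of_isClosed isClosed_Icc isClosed_Iic) Set.inter_subset_left
  have hpos : ∀ t ∈ Set.Icc a b ∩ P g q ⁻¹' Set.Iic 0, 0 < P g c t := by
    rintro t ⟨ht, htq⟩
    refine lt_of_le_of_ne (hc t ht) fun h => ?_
    exact absurd (hq t ht h.symm) (not_lt.2 htq)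
  obtain ⟨M, hM⟩ := isCompact_Icc.exists_bound_of_continuousOn (P_cont hg q)
  obtain ⟨η, hη, hηt⟩ : ∃ η > 0, ∀ t ∈ Set.Icc a b ∩ P g q ⁻¹' Set.Iic 0, η ≤ P g c t := by
    rcases (Set.Icc a b ∩ P g q ⁻¹' Set.Iic 0).eq_empty_or_nonempty with he | hne
    · exact ⟨1, one_pos, by simp [he]⟩
    · obtain ⟨x, hx, hmin⟩ := hcomp.exists_isMinOn hne ((P_cont hg c).mono Set.inter_subset_left)
      exact ⟨P g c x, hpos x hx, fun t ht => hmin ht⟩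
  have hM1 : 0 < |M| + 1 := by positivity
  refine ⟨η / (|M| + 1), by positivity, fun t ht => ?_⟩
  rw [P_add, P_smul]
  rcases le_or_gt (P g q t) 0 with h | h
  · have h1 := hηt t ⟨ht, h⟩
    have h2 := hM t ht
    rw [Real.norm_eq_abs] at h2
    have h3 : -(|M| + 1) < P g q t := by linarith [neg_abs_le (P g q t), le_abs_self M]
    have h4 : η / (|M| + 1) * -(|M| + 1) < η / (|M| + 1) * P g q t :=
      mul_lt_mul_of_pos_left h3 (by positivity)
    have h5 : η / (|M| + 1) * -(|M| + 1) = -η := by field_simp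
    linarith
  · have : 0 < η / (|M| + 1) * P g q t := by positivity
    linarith [hc t ht]


/-- The determinant has constant sign on the ordered simplex. -/
lemma const_sign (hg : ∀ j, ContinuousOn (g j) (Set.Icc a b)) (hT : IsTchebyshevSystem a b g) :
    ∃ σ : ℝ, ∀ y : Fin N → ℝ, StrictMono y → (∀ i, y i ∈ Set.Icc a b) →
      0 < σ * (Matrix.of fun i j => g j (y i)).det := by
  classical
  let S : Set (Fin N → ℝ) := {y | StrictMono y ∧ ∀ i, y i ∈ Set.Icc a b}
  let D : (Fin N → ℝ) → ℝ := fun y => (Matrix.of fun i j => g j (y i)).det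
  have hconv : Convex ℝ S := by
    intro y hy z hz r s hr hs hrs
    refine ⟨fun i j hij => ?_, fun i => ?_⟩
    · have h1 := hy.1 hij
      have h2 := hz.1 hij
      simp only [Pi.add_apply, Pi.smul_apply, smul_eq_mul]
      rcases hr.eq_or_lt with h | h
      · have : s = 1 := by linarith
        subst this; rw [← h]; linarith
      · have := mul_lt_mul_of_pos_left h1 h
        have := mul_le_mul_of_nonneg_left h2.le hs
        linarith
    · exact convex_Icc a b (hy.2 i) (hz.2 i) hr hs hrs
  have hD : ContinuousOn D S := by
    rw [continuousOn_iff_continuous_domRestrict]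
    refine Continuous.matrix_det ?_
    refine continuous_matrix fun i j => ?_
    have : ContinuousOn (fun y : Fin N → ℝ => g j (y i)) S :=
      (hg j).comp (continuous_apply i).continuousOn fun y hy => hy.2 i
    exact continuousOn_iff_continuous_domRestrict.1 this
  by_cases hne : S.Nonempty
  · obtain ⟨y0, hy0⟩ := hne
    refine ⟨D y0, fun y hy hyI => ?_⟩
    change 0 < D y0 * D y
    by_contra hle
    push Not at hle
    have h0 : D y0 ≠ 0 := hT y0 hy0.1 hy0.2
    have h1 : D y ≠ 0 := hT y hy hyI
    have hlt := lt_of_le_of_ne hle (mul_ne_zero h0 h1)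
    have hoc := (hconv.isPreconnected.image D hD).ordConnected
    have m0 : D y0 ∈ D '' S := ⟨y0, hy0, rfl⟩
    have m1 : D y ∈ D '' S := ⟨y, ⟨hy, hyI⟩, rfl⟩
    have hz : (0 : ℝ) ∈ D '' S := by
      rcases mul_neg_iff.1 hlt with ⟨h2, h3⟩ | ⟨h2, h3⟩
      · exact hoc.out m1 m0 ⟨h3.le, h2.le⟩
      · exact hoc.out m0 m1 ⟨h2.le, h3.le⟩
    obtain ⟨z, hz, hz0⟩ := hz
    exact hT z hz.1 hz.2 hz0
  · exact ⟨0, fun y hy hyI => absurd ⟨y, hy, hyI⟩ hne⟩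

lemma exists_sign_poly {m : ℕ} (hN : N = m + 1) (hg : ∀ j, ContinuousOn (g j) (Set.Icc a b))
    (hT : IsTchebyshevSystem a b g) (y : Fin m → ℝ) :
    ∃ c : Fin N → ℝ, (∀ k, P g c (y k) = 0) ∧
      ∀ (s : ℝ) (i : Fin (m + 1)), Even (i : ℕ) →
        StrictMono (i.insertNth (α := fun _ => ℝ) s y) →
        (∀ k, i.insertNth (α := fun _ => ℝ) s y k ∈ Set.Icc a b) → 0 < P g c s := by
  subst hN
  obtain ⟨σ, hσ⟩ := const_sign hg hT
  let c : Fin (m + 1) → ℝ := fun j => σ * ((-1) ^ (j : ℕ) *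
    (Matrix.of fun (k : Fin m) (l : Fin m) => g (j.succAbove l) (y k)).det)
  have key : ∀ (s : ℝ) (i : Fin (m + 1)), Even (i : ℕ) → P g c s =
      σ * (Matrix.of fun k j => g j (i.insertNth (α := fun _ => ℝ) s y k)).det := by
    intro s i hi
    rw [Matrix.det_succ_row _ i, P, Finset.mul_sum]
    refine Finset.sum_congr rfl fun j _ => ?_
    have : (Matrix.of fun k j => g j (i.insertNth (α := fun _ => ℝ) s y k)).submatrix
        i.succAbove j.succAbove = Matrix.of fun (k : Fin m) (l : Fin m) =>
          g (j.succAbove l) (y k) := by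
      ext k l; simp
    rw [this, pow_add, hi.neg_one_pow]
    simp only [Matrix.of_apply, Fin.insertNth_apply_same, c]
    ring
  refine ⟨c, fun k => ?_, fun s i hi hm hI => ?_⟩
  · rw [key (y k) 0 (by simp)]
    rw [Matrix.det_zero_of_row_eq (i := 0) (j := k.succ) (Fin.succ_ne_zero k).symm, mul_zero]
    ext j
    simp
  · rw [key s i hi]
    exact hσ _ hm hI

lemma strictMono_insertNth {m : ℕ} (y : Fin m → ℝ) (hy : StrictMono y) (s : ℝ) (i : Fin (m + 1))
    (h1 : ∀ k : Fin m, (k : ℕ) < i → y k < s) (h2 : ∀ k : Fin m, (i : ℕ) ≤ k → s < y k) :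
    StrictMono (i.insertNth (α := fun _ => ℝ) s y) := by
  intro u v huv
  rcases Fin.eq_self_or_eq_succAbove i u with rfl | ⟨u, rfl⟩
  · rcases Fin.eq_self_or_eq_succAbove u v with rfl | ⟨v, rfl⟩
    · exact absurd huv (lt_irrefl _)
    · simp only [Fin.insertNth_apply_same, Fin.insertNth_apply_succAbove]
      apply h2
      by_contra hlt
      push Not at hlt
      rw [Fin.succAbove_of_castSucc_lt _ _ (by exact hlt)] at huv
      exact absurd huv (not_lt.2 (by rw [Fin.le_def]; simp; omega))
  · rcases Fin.eq_self_or_eq_succAbove i v with rfl | ⟨w, rfl⟩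
    · simp only [Fin.insertNth_apply_same, Fin.insertNth_apply_succAbove]
      apply h1
      by_contra hlt
      push Not at hlt
      rw [Fin.succAbove_of_le_castSucc _ _ (by exact hlt)] at huv
      exact absurd huv (not_lt.2 (by rw [Fin.le_def]; simp; omega))
    · simp only [Fin.insertNth_apply_succAbove]
      exact hy ((Fin.strictMono_succAbove i).lt_iff_lt.1 huv)

open Filter Topology in
/-- Nonnegative polynomial with `p` double zeros in `[a,b)` and a zero at `b`. -/
lemma exists_nonneg {p : ℕ} (hN : N = 2 * p + 1 + 1) (hab : a < b)
    (hg : ∀ j, ContinuousOn (g j) (Set.Icc a b))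
    (hT : IsTchebyshevSystem a b g) (t : ℕ → ℝ) (ht : ∀ i < p, t i < t (i + 1)) (ha : a ≤ t 0)
    (hb : t p = b) :
    ∃ c : Fin N → ℝ, c ≠ 0 ∧ (∀ s ∈ Set.Icc a b, 0 ≤ P g c s) ∧ ∀ i ≤ p, P g c (t i) = 0 := by
  have hmono : ∀ i j : ℕ, i ≤ j → j ≤ p → t i ≤ t j := by
    intro i j hij
    induction j, hij using Nat.le_induction with
    | base => intro _; exact le_rfl
    | succ k hk ih => intro hkN; exact (ih (by omega)).trans (ht k (by omega)).le
  have hsmono : ∀ i j : ℕ, i < j → j ≤ p → t i < t j := fun i j hij hj =>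
    (ht i (by omega)).trans_le (hmono (i + 1) j hij hj)
  let y : ℝ → Fin (2 * p + 1) → ℝ := fun ε k => t (k / 2) + ((k % 2 : ℕ) : ℝ) * ε
  choose C hC0 hCpos using fun ε => exists_sign_poly hN hg hT (y ε)
  -- gaps
  have hgap : ∀ᶠ ε : ℝ in 𝓝[>] 0, ∀ i ∈ Finset.range p, t i + ε < t (i + 1) := by
    rw [Filter.eventually_all_finset]
    intro i hi
    have : ∀ᶠ ε : ℝ in 𝓝 0, ε < t (i + 1) - t i :=
      eventually_lt_nhds (by linarith [ht i (by simpa using hi)])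
    filter_upwards [this.filter_mono nhdsWithin_le_nhds] with ε hε
    linarith
  have hpos : ∀ᶠ ε : ℝ in 𝓝[>] 0, 0 < ε := self_mem_nhdsWithin
  have hmain : ∀ s ∈ Set.Icc a b, (∀ i ≤ p, s ≠ t i) → ∀ᶠ ε : ℝ in 𝓝[>] 0, 0 < P g (C ε) s := by
    intro s hs hst
    have hex : ∃ q, s < t q := ⟨p, by
      rw [hb]; exact lt_of_le_of_ne hs.2 (by rw [← hb]; exact hst p le_rfl)⟩
    classical
    have hq := Nat.find_spec hex
    have hqm : ∀ {k}, k < Nat.find hex → ¬ s < t k := fun hk => Nat.find_min hex hk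
    have hqp : Nat.find hex ≤ p := Nat.find_min' hex (by
      rw [hb]; exact lt_of_le_of_ne hs.2 (by rw [← hb]; exact hst p le_rfl))
    generalize Nat.find hex = q at hq hqm hqp
    have hlow : ∀ k < q, t k < s := fun k hk =>
      lt_of_le_of_ne (not_lt.1 (hqm hk)) (hst k (by omega)).symm
    have hlowε : ∀ᶠ ε : ℝ in 𝓝[>] 0, ∀ k ∈ Finset.range q, t k + ε < s := by
      rw [Filter.eventually_all_finset]
      intro k hk
      have : ∀ᶠ ε : ℝ in 𝓝 0, ε < s - t k :=
        eventually_lt_nhds (by linarith [hlow k (by simpa using hk)])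
      filter_upwards [this.filter_mono nhdsWithin_le_nhds] with ε hε
      linarith
    filter_upwards [hgap, hpos, hlowε] with ε h1 h2 h3
    have hybd : ∀ k : Fin (2 * p + 1), t (k / 2) ≤ y ε k ∧ y ε k ≤ t (k / 2) + ε ∧ y ε k ≤ b := by
      intro k
      have hk := k.2
      rcases Nat.mod_two_eq_zero_or_one k with h | h
      · have : y ε k = t (k / 2) := by simp [y, h]
        rw [this]
        refine ⟨le_rfl, by linarith, ?_⟩
        rw [← hb]; exact hmono _ _ (by omega) le_rfl
      · have : y ε k = t (k / 2) + ε := by simp [y, h]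
        rw [this]
        refine ⟨by linarith, le_rfl, ?_⟩
        rw [← hb]
        exact (h1 (k / 2) (by simp; omega)).le.trans (hmono _ _ (by omega) le_rfl)
    have hyI : ∀ k, y ε k ∈ Set.Icc a b := fun k =>
      ⟨ha.trans ((hmono 0 _ (Nat.zero_le _) (by have := k.2; omega)).trans (hybd k).1),
        (hybd k).2.2⟩
    have hym : StrictMono (y ε) := by
      intro k l hkl
      have hkl' : (k : ℕ) < l := hkl
      have hl := l.2
      rcases Nat.lt_or_ge (k / 2 : ℕ) (l / 2) with h | h
      · have e1 := h1 (k / 2) (by simp; omega)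
        have e2 := hmono ((k : ℕ) / 2 + 1) (l / 2) h (by omega)
        linarith [(hybd k).2.1, (hybd l).1]
      · have e1 : (k : ℕ) / 2 = l / 2 := by omega
        have e2 : (k : ℕ) % 2 = 0 := by omega
        have e3 : (l : ℕ) % 2 = 1 := by omega
        simp only [y, e1, e2, e3]
        simpa using h2
    refine hCpos ε s ⟨2 * q, by omega⟩ (by simp) ?_ ?_
    · refine strictMono_insertNth (y ε) hym s _ ?_ ?_
      · intro k hk
        have hk : (k : ℕ) < 2 * q := hk
        exact (hybd k).2.1.trans_lt (h3 (k / 2) (by simp; omega))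
      · intro k hk
        have hk : 2 * q ≤ (k : ℕ) := hk
        have := k.2
        exact hq.trans_le ((hmono q (k / 2) (by omega) (by omega)).trans (hybd k).1)
    · intro k
      rcases Fin.eq_self_or_eq_succAbove (⟨2 * q, by omega⟩ : Fin (2 * p + 1 + 1)) k with h | ⟨l, h⟩
      · rw [h, Fin.insertNth_apply_same]; exact hs
      · rw [h, Fin.insertNth_apply_succAbove]; exact hyI l
  -- a test point
  obtain ⟨s0, hs0, hs0t⟩ : ∃ s ∈ Set.Icc a b, ∀ i ≤ p, s ≠ t i := by
    obtain ⟨s, hs, hn⟩ := (Set.Icc_infinite hab).exists_notMem_finset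
      ((Finset.range (p + 1)).image t)
    refine ⟨s, hs, fun i hi h => hn ?_⟩
    rw [Finset.mem_image]
    exact ⟨i, by simp; omega, h.symm⟩
  have hne : ∀ᶠ ε : ℝ in 𝓝[>] 0, C ε ≠ 0 := by
    filter_upwards [hmain s0 hs0 hs0t] with ε h h0
    rw [h0, P_zero] at h
    exact lt_irrefl _ h
  let E : ℝ → Fin N → ℝ := fun ε => ‖C ε‖⁻¹ • C ε
  let U : Ultrafilter ℝ := Ultrafilter.of (𝓝[>] (0 : ℝ))
  have hU : (U : Filter ℝ) ≤ 𝓝[>] 0 := Ultrafilter.of_le _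
  have hsph : ∀ᶠ ε in (U : Filter ℝ), E ε ∈ Metric.sphere (0 : Fin N → ℝ) 1 := by
    filter_upwards [hne.filter_mono hU] with ε h
    simp only [E, mem_sphere_zero_iff_norm]
    rw [norm_smul, norm_inv, norm_norm, inv_mul_cancel₀ (norm_ne_zero_iff.2 h)]
  obtain ⟨c, hc, hlim⟩ := (isCompact_sphere (0 : Fin N → ℝ) 1).ultrafilter_le_nhds (U.map E)
    (by rw [le_principal_iff]; exact hsph)
  have hlim : Tendsto E U (𝓝 c) := hlim
  have hPlim : ∀ s, Tendsto (fun ε => P g (E ε) s) U (𝓝 (P g c s)) := fun s =>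
    ((P_cont_coef s).tendsto c).comp hlim
  have hzero : ∀ i ≤ p, P g c (t i) = 0 := by
    intro i hi
    have : ∀ ε, P g (E ε) (t i) = 0 := by
      intro ε
      have := hC0 ε ⟨2 * i, by omega⟩
      simp only [y] at this
      simp only [E, P_smul]
      have e : 2 * i / 2 = i := by omega
      simp [e] at this
      simp [this]
    refine tendsto_nhds_unique (hPlim (t i)) ?_
    simp only [this]
    exact tendsto_const_nhds
  refine ⟨c, ?_, ?_, hzero⟩
  · rintro rfl
    simp at hc
  · intro s hs
    by_cases h : ∃ i ≤ p, s = t i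
    · obtain ⟨i, hi, rfl⟩ := h
      exact (hzero i hi).ge
    · push Not at h
      refine ge_of_tendsto (hPlim s) ?_
      filter_upwards [(hmain s hs h).filter_mono hU] with ε hε
      simp only [E, P_smul]
      positivity

lemma exists_nonneg_finset {p : ℕ} (hN : N = 2 * p + 1 + 1) (hab : a < b)
    (hg : ∀ j, ContinuousOn (g j) (Set.Icc a b))
    (hT : IsTchebyshevSystem a b g) (W : Finset ℝ) (hW : ↑W ⊆ Set.Ico a b) (hc : W.card = p) :
    ∃ c : Fin N → ℝ, c ≠ 0 ∧ (∀ s ∈ Set.Icc a b, 0 ≤ P g c s) ∧ (∀ s ∈ W, P g c s = 0) ∧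
      P g c b = 0 := by
  let t : ℕ → ℝ := fun i => if h : i < p then W.orderEmbOfFin hc ⟨i, h⟩ else b
  have htp : t p = b := by simp [t]
  have htm : ∀ (i : ℕ) (h : i < p), t i = W.orderEmbOfFin hc ⟨i, h⟩ := fun i h => by simp [t, h]
  have hlt : ∀ i : Fin p, W.orderEmbOfFin hc i ∈ Set.Ico a b :=
    fun i => hW (W.orderEmbOfFin_mem hc i)
  obtain ⟨c, h0, h1, h2⟩ := exists_nonneg hN hab hg hT t (by
      intro i hi
      by_cases h : i + 1 < p
      · rw [htm i hi, htm _ h]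
        exact (W.orderEmbOfFin hc).strictMono (by simp [Fin.lt_def])
      · have : i + 1 = p := by omega
        rw [this, htp, htm i hi]
        exact (hlt _).2) (by
      by_cases h : 0 < p
      · rw [htm 0 h]; exact (hlt _).1
      · have : p = 0 := by omega
        rw [show t 0 = b by simp [t, this]]
        exact hab.le) htp
  refine ⟨c, h0, h1, fun s hs => ?_, by rw [← htp]; exact h2 p le_rfl⟩
  have : s ∈ Set.range (W.orderEmbOfFin hc) := by
    rw [Finset.range_orderEmbOfFin]; exact hs
  obtain ⟨i, rfl⟩ := this
  have := h2 i i.2.le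
  rwa [htm i i.2] at this

lemma exists_between_pos (hT : IsTchebyshevSystem a b g) (c : Fin N → ℝ) (h0 : c ≠ 0)
    (hc : ∀ s ∈ Set.Icc a b, 0 ≤ P g c s) (u v : ℝ) (hu : a ≤ u) (hv : v ≤ b) (huv : u < v) :
    ∃ s, u < s ∧ s < v ∧ 0 < P g c s := by
  obtain ⟨Z, hZ, -⟩ := zeros hT c h0
  obtain ⟨s, hs, hn⟩ := (Set.Ioo_infinite huv).exists_notMem_finset Z
  have hsI : s ∈ Set.Icc a b := ⟨hu.trans hs.1.le, hs.2.le.trans hv⟩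
  refine ⟨s, hs.1, hs.2, lt_of_le_of_ne (hc s hsI) fun h => hn ((hZ s).2 ⟨hsI, h.symm⟩)⟩

/-- A nonnegative polynomial has at most `n` zeros. -/
lemma count_le {n : ℕ} (hN : N = 2 * n) (hn : 1 ≤ n) (hab : a < b)
    (hg : ∀ j, ContinuousOn (g j) (Set.Icc a b))
    (hT : IsTchebyshevSystem a b g) (c : Fin N → ℝ) (h0 : c ≠ 0)
    (hc : ∀ s ∈ Set.Icc a b, 0 ≤ P g c s)
    (Z : Finset ℝ) (hZ : ∀ t ∈ Z, t ∈ Set.Icc a b ∧ P g c t = 0) : Z.card ≤ n := by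
  by_contra hcard
  push Not at hcard
  obtain ⟨W, hWZ, hWc⟩ := Finset.exists_subset_card_eq (show n + 1 ≤ Z.card from hcard)
  let z : ℕ → ℝ := fun i => if h : i < n + 1 then W.orderEmbOfFin hWc ⟨i, h⟩ else 0
  have hz : ∀ i, (h : i < n + 1) → z i = W.orderEmbOfFin hWc ⟨i, h⟩ := fun i h => dif_pos h
  have hz0 : ∀ i ≤ n, z i ∈ Set.Icc a b ∧ P g c (z i) = 0 := by
    intro i hi
    rw [hz i (by omega)]
    exact hZ _ (hWZ (W.orderEmbOfFin_mem hWc _))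
  have hzm : ∀ i < n, z i < z (i + 1) := by
    intro i hi
    rw [hz i (by omega), hz (i + 1) (by omega)]
    exact (W.orderEmbOfFin hWc).strictMono (by simp [Fin.lt_def])
  have hm : ∀ i, ∃ s, i < n → z i < s ∧ s < z (i + 1) ∧ 0 < P g c s := by
    intro i
    by_cases hi : i < n
    · obtain ⟨s, hs⟩ := exists_between_pos hT c h0 hc (z i) (z (i + 1)) (hz0 i hi.le).1.1
        (hz0 (i + 1) hi).1.2 (hzm i hi)
      exact ⟨s, fun _ => hs⟩
    · exact ⟨0, fun h => absurd h hi⟩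
  choose m hm using hm
  let y : ℕ → ℝ := fun i => if i % 2 = 0 then z (i / 2) else m (i / 2)
  have hy0 : ∀ i, y (2 * i) = z i := fun i => by
    simp [y]
  have hy1 : ∀ i, y (2 * i + 1) = m i := fun i => by
    have e1 : (2 * i + 1) % 2 = 1 := by omega
    have e2 : (2 * i + 1) / 2 = i := by omega
    simp [y, e1, e2]
  refine alt_nonneg hab hg hT y ?_ ?_ c (by omega) h0 ?_
  · intro i hi
    obtain ⟨k, rfl | rfl⟩ := Nat.even_or_odd' i
    · rw [hy0, hy1]; exact (hm k (by omega)).1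
    · rw [hy1, show 2 * k + 1 + 1 = 2 * (k + 1) by ring, hy0]; exact (hm k (by omega)).2.1
  · intro i hi
    obtain ⟨k, rfl | rfl⟩ := Nat.even_or_odd' i
    · rw [hy0]; exact (hz0 k (by omega)).1
    · rw [hy1]
      have := hm k (by omega)
      exact ⟨(hz0 k (by omega)).1.1.trans this.1.le,
        this.2.1.le.trans (hz0 (k + 1) (by omega)).1.2⟩
  · intro i hi
    obtain ⟨k, rfl | rfl⟩ := Nat.even_or_odd' i
    · rw [hy0, hy1]; exact Or.inl ⟨(hz0 k (by omega)).2, (hm k (by omega)).2.2⟩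
    · rw [hy1, show 2 * k + 1 + 1 = 2 * (k + 1) by ring, hy0]
      exact Or.inr ⟨(hm k (by omega)).2.2, (hz0 (k + 1) (by omega)).2⟩

/-- A nonnegative polynomial, positive at the endpoints, has fewer than `n` zeros. -/
lemma count_lt {n : ℕ} (hN : N = 2 * n) (hn : 1 ≤ n) (hab : a < b)
    (hg : ∀ j, ContinuousOn (g j) (Set.Icc a b))
    (hT : IsTchebyshevSystem a b g) (c : Fin N → ℝ) (h0 : c ≠ 0)
    (hc : ∀ s ∈ Set.Icc a b, 0 ≤ P g c s) (hca : 0 < P g c a) (hcb : 0 < P g c b)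
    (Z : Finset ℝ) (hZ : ∀ t ∈ Z, t ∈ Set.Icc a b ∧ P g c t = 0) : Z.card < n := by
  by_contra hcard
  push Not at hcard
  obtain ⟨W, hWZ, hWc⟩ := Finset.exists_subset_card_eq hcard
  let z : ℕ → ℝ := fun i => if h : i < n then W.orderEmbOfFin hWc ⟨i, h⟩ else 0
  have hz : ∀ i, (h : i < n) → z i = W.orderEmbOfFin hWc ⟨i, h⟩ := fun i h => dif_pos h
  have hz0 : ∀ i < n, z i ∈ Set.Icc a b ∧ P g c (z i) = 0 := by
    intro i hi
    rw [hz i (by omega)]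
    exact hZ _ (hWZ (W.orderEmbOfFin_mem hWc _))
  have hza : ∀ i < n, a < z i := fun i hi => lt_of_le_of_ne (hz0 i hi).1.1 fun h => by
    have := (hz0 i hi).2
    rw [← h] at this
    exact hca.ne' this
  have hzb : ∀ i < n, z i < b := fun i hi => lt_of_le_of_ne (hz0 i hi).1.2 fun h => by
    have := (hz0 i hi).2
    rw [h] at this
    exact hcb.ne' this
  have hzm : ∀ i, i + 1 < n → z i < z (i + 1) := by
    intro i hi
    rw [hz i (by omega), hz (i + 1) (by omega)]
    exact (W.orderEmbOfFin hWc).strictMono (by simp [Fin.lt_def])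
  have hm : ∀ i, ∃ s, i ≤ n → (s ∈ Set.Icc a b ∧ (0 < i → z (i - 1) < s) ∧ (i < n → s < z i) ∧
      0 < P g c s) := by
    intro i
    by_cases hi0 : i = 0
    · subst hi0
      exact ⟨a, fun _ => ⟨⟨le_rfl, hab.le⟩, fun h => absurd h (lt_irrefl _), fun h => hza 0 h, hca⟩⟩
    by_cases hin : n ≤ i
    · exact ⟨b, fun _ => ⟨⟨hab.le, le_rfl⟩, fun h => hzb _ (by omega), fun h => by omega, hcb⟩⟩
    push Not at hin
    have h3 := hzm (i - 1) (by omega)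
    rw [show i - 1 + 1 = i by omega] at h3
    obtain ⟨s, hs⟩ := exists_between_pos hT c h0 hc (z (i - 1)) (z i) (hz0 _ (by omega)).1.1
        (hz0 i hin).1.2 h3
    exact ⟨s, fun _ => ⟨⟨(hz0 (i - 1) (by omega)).1.1.trans hs.1.le,
      hs.2.1.le.trans (hz0 i hin).1.2⟩, fun _ => hs.1, fun _ => hs.2.1, hs.2.2⟩⟩
  choose m hm using hm
  let y : ℕ → ℝ := fun i => if i % 2 = 0 then m (i / 2) else z (i / 2)
  have hy0 : ∀ i, y (2 * i) = m i := fun i => by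
    simp [y]
  have hy1 : ∀ i, y (2 * i + 1) = z i := fun i => by
    have e1 : (2 * i + 1) % 2 = 1 := by omega
    have e2 : (2 * i + 1) / 2 = i := by omega
    simp [y, e1, e2]
  refine alt_nonneg hab hg hT y ?_ ?_ c (by omega) h0 ?_
  · intro i hi
    obtain ⟨k, rfl | rfl⟩ := Nat.even_or_odd' i
    · rw [hy0, hy1]; exact (hm k (by omega)).2.2.1 (by omega)
    · rw [hy1, show 2 * k + 1 + 1 = 2 * (k + 1) by ring, hy0]
      exact (hm (k + 1) (by omega)).2.1 (by omega)
  · intro i hi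
    obtain ⟨k, rfl | rfl⟩ := Nat.even_or_odd' i
    · rw [hy0]; exact (hm k (by omega)).1
    · rw [hy1]; exact (hz0 k (by omega)).1
  · intro i hi
    obtain ⟨k, rfl | rfl⟩ := Nat.even_or_odd' i
    · rw [hy0, hy1]; exact Or.inr ⟨(hm k (by omega)).2.2.2, (hz0 k (by omega)).2⟩
    · rw [hy1, show 2 * k + 1 + 1 = 2 * (k + 1) by ring, hy0]
      exact Or.inl ⟨(hz0 k (by omega)).2, (hm (k + 1) (by omega)).2.2.2⟩

/-- Abstract form: a linear functional strictly positive on nonnegative polynomials. -/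
lemma main_functional {n : ℕ} (hN : N = 2 * n) (hn : 1 ≤ n) (hab : a < b)
    (hg : ∀ j, ContinuousOn (g j) (Set.Icc a b))
    (hT : IsTchebyshevSystem a b g) (L : (Fin N → ℝ) →ₗ[ℝ] ℝ)
    (hL : ∀ c : Fin N → ℝ, c ≠ 0 → (∀ s ∈ Set.Icc a b, 0 ≤ P g c s) → 0 < L c) :
    ∃ (Z : Finset ℝ) (μ : ℝ → ℝ), Z.card = n + 1 ∧ ↑Z ⊆ Set.Icc a b ∧ a ∈ Z ∧ b ∈ Z ∧
      (∀ z ∈ Z, 0 < μ z) ∧ ∀ c, L c = ∑ z ∈ Z, μ z * P g c z := by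
  classical
  obtain ⟨p, rfl⟩ : ∃ p, n = p + 1 := ⟨n - 1, by omega⟩
  have hIco : (Set.Ico a b).Infinite := Set.Ico_infinite hab
  have haI : a ∈ Set.Icc a b := ⟨le_rfl, hab.le⟩
  have hbI : b ∈ Set.Icc a b := ⟨hab.le, le_rfl⟩
  -- a strictly positive polynomial
  obtain ⟨c1, hc1, hc1b⟩ : ∃ c : Fin N → ℝ, (∀ s ∈ Set.Icc a b, 0 ≤ P g c s) ∧ 0 < P g c b := by
    obtain ⟨W, -, hW, hWc⟩ := extend hIco ∅ (by simp) p (by simp)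
    obtain ⟨c, h0, h1, -, -⟩ := exists_nonneg_finset (by omega) hab hg hT W hW hWc
    obtain ⟨Z, hZ, hZc⟩ := zeros hT c h0
    obtain ⟨q, hq⟩ := interp hab hT Z (fun t ht => ((hZ t).1 ht).1) hZc (fun _ => 1)
    obtain ⟨δ, hδ, h⟩ := perturb hg c q h1 (fun t ht h => by
      rw [hq t ((hZ t).2 ⟨ht, h⟩)]; exact one_pos)
    exact ⟨_, fun s hs => (h s hs).le, h b hbI⟩
  have hLc : Continuous L := L.continuous_of_finiteDimensional
  let B : Set (Fin N → ℝ) := Metric.sphere 0 1 ∩ {c | ∀ s ∈ Set.Icc a b, 0 ≤ P g c s}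
  have hBcl : IsClosed {c : Fin N → ℝ | ∀ s ∈ Set.Icc a b, 0 ≤ P g c s} := by
    have : {c : Fin N → ℝ | ∀ s ∈ Set.Icc a b, 0 ≤ P g c s} =
        ⋂ s ∈ Set.Icc a b, {c | 0 ≤ P g c s} := by ext; simp
    rw [this]
    exact isClosed_biInter fun s _ => isClosed_le continuous_const (P_cont_coef s)
  have hBc : IsCompact B := (isCompact_sphere _ _).inter_right hBcl
  have hBne : ∀ c ∈ B, c ≠ 0 := by
    rintro c hc rfl
    simpa using hc.1
  have hscale : ∀ c : Fin N → ℝ, c ≠ 0 → (∀ s ∈ Set.Icc a b, 0 ≤ P g c s) → ‖c‖⁻¹ • c ∈ B := by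
    intro c h0 hc
    refine ⟨?_, fun s hs => ?_⟩
    · rw [mem_sphere_zero_iff_norm, norm_smul, norm_inv, norm_norm,
        inv_mul_cancel₀ (norm_ne_zero_iff.2 h0)]
    · rw [P_smul]; exact mul_nonneg (by positivity) (hc s hs)
  have hc10 : c1 ≠ 0 := by rintro rfl; simp [P_zero] at hc1b
  obtain ⟨c, hcB, hmax⟩ := hBc.exists_isMaxOn ⟨_, hscale c1 hc10 hc1⟩
    (f := fun c => P g c b / L c)
    ((P_cont_coef b).continuousOn.div hLc.continuousOn fun c hc => (hL c (hBne c hc) hc.2).ne')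
  have hc0 := hBne c hcB
  have hcn := hcB.2
  have hLcp := hL c hc0 hcn
  -- extremality
  have hrat : ∀ d : Fin N → ℝ, d ≠ 0 → (∀ s ∈ Set.Icc a b, 0 ≤ P g d s) →
      P g d b / L d ≤ P g c b / L c := by
    intro d hd0 hd
    have h := hmax (hscale d hd0 hd)
    simp only [P_smul, map_smul, smul_eq_mul, Set.mem_ofPred_eq] at h
    rwa [mul_div_mul_left _ _ (inv_ne_zero (norm_ne_zero_iff.2 hd0))] at h
  have hcb : 0 < P g c b := by
    have h1 := hrat c1 hc10 hc1
    have h2 : 0 < P g c1 b / L c1 := div_pos hc1b (hL c1 hc10 hc1)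
    exact (div_pos_iff_of_pos_right hLcp).1 (h2.trans_le h1)
  obtain ⟨lam, hlamdef⟩ : ∃ lam, lam = L c / P g c b := ⟨_, rfl⟩
  have hlam : 0 < lam := by rw [hlamdef]; positivity
  have hF : ∀ d : Fin N → ℝ, (∀ s ∈ Set.Icc a b, 0 ≤ P g d s) → 0 ≤ L d - lam * P g d b := by
    intro d hd
    by_cases hd0 : d = 0
    · simp [hd0, P_zero]
    have h := hrat d hd0 hd
    have hLd := hL d hd0 hd
    rw [div_le_div_iff₀ hLd hLcp] at h
    rw [hlamdef, div_mul_eq_mul_div, sub_nonneg, div_le_iff₀ hcb]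
    linarith
  have hF0 : L c - lam * P g c b = 0 := by
    rw [hlamdef, div_mul_cancel₀ _ hcb.ne', sub_self]
  obtain ⟨Z, hZ, hZc⟩ := zeros hT c hc0
  have hZI : ↑Z ⊆ Set.Icc a b := fun t ht => ((hZ t).1 ht).1
  have hbZ : b ∉ Z := fun h => hcb.ne' ((hZ b).1 h).2
  obtain ⟨R, hR⟩ := interp hab hT Z hZI hZc (fun _ => 1)
  -- optimality conditions
  have hstrict : ∀ d : Fin N → ℝ, (∀ z ∈ Z, 0 < P g d z) → 0 ≤ L d - lam * P g d b := by
    intro d hd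
    obtain ⟨δ, hδ, h⟩ := perturb hg c d hcn (fun t ht h => hd t ((hZ t).2 ⟨ht, h⟩))
    have := hF _ fun s hs => (h s hs).le
    rw [map_add, map_smul, P_add, P_smul, smul_eq_mul] at this
    have h2 : 0 ≤ δ * (L d - lam * P g d b) := by linarith
    exact nonneg_of_mul_nonneg_right h2 hδ
  have hkkt : ∀ d : Fin N → ℝ, (∀ z ∈ Z, 0 ≤ P g d z) → 0 ≤ L d - lam * P g d b := by
    intro d hd
    have h : ∀ η : ℝ, 0 < η → 0 ≤ (L d - lam * P g d b) + η * (L R - lam * P g R b) := by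
      intro η hη
      have := hstrict (d + η • R) (fun z hz => by
        rw [P_add, P_smul, hR z hz]; linarith [hd z hz])
      rw [map_add, map_smul, P_add, P_smul, smul_eq_mul] at this
      linarith
    by_contra hneg
    push Not at hneg
    set u := L d - lam * P g d b
    set v := L R - lam * P g R b
    have h1 := h (-u / (2 * (|v| + 1))) (div_pos (by linarith) (by positivity))
    have h2 : -u / (2 * (|v| + 1)) * v ≤ -u / (2 * (|v| + 1)) * (|v| + 1) :=
      mul_le_mul_of_nonneg_left (by linarith [le_abs_self v])
        (div_pos (by linarith) (by positivity)).le
    have h3 : -u / (2 * (|v| + 1)) * (|v| + 1) = -u / 2 := by field_simp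
    linarith
  choose q hq using fun z : ℝ => interp hab hT Z hZI hZc (fun t => if t = z then 1 else 0)
  let μ : ℝ → ℝ := fun z => L (q z) - lam * P g (q z) b
  have hμ : ∀ z, 0 ≤ μ z := fun z => hkkt _ fun t ht => by
    rw [hq z t ht]; split_ifs <;> norm_num
  have hrep : ∀ d, L d = lam * P g d b + ∑ z ∈ Z, μ z * P g d z := by
    intro d
    set e := ∑ z ∈ Z, P g d z • q z with he
    have hez : ∀ t ∈ Z, P g e t = P g d t := by
      intro t ht
      rw [he, P_sum]
      have : ∀ z ∈ Z, P g (P g d z • q z) t = if t = z then P g d z else 0 := by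
        intro z _
        rw [P_smul, hq z t ht]; split_ifs <;> simp
      rw [Finset.sum_congr rfl this]
      simp [ht]
    have h1 := hkkt (d - e) fun t ht => by rw [P_sub, hez t ht, sub_self]
    have h2 := hkkt (e - d) fun t ht => by rw [P_sub, hez t ht, sub_self]
    rw [map_sub, P_sub] at h1 h2
    have h3 : L e - lam * P g e b = ∑ z ∈ Z, μ z * P g d z := by
      rw [he, map_sum, P_sum, Finset.mul_sum, ← Finset.sum_sub_distrib]
      refine Finset.sum_congr rfl fun z _ => ?_
      rw [map_smul, P_smul, smul_eq_mul]
      simp only [μ]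
      ring
    linarith
  -- counting
  have hcardpos : p + 1 ≤ (Z.filter fun z => 0 < μ z).card := by
    by_contra hlt
    push Not at hlt
    obtain ⟨W, hZW, hW, hWc⟩ := extend hIco (Z.filter fun z => 0 < μ z) (by
      intro z hz
      have hz := (Finset.mem_filter.1 (Finset.mem_coe.1 hz)).1
      exact ⟨(hZI hz).1, lt_of_le_of_ne (hZI hz).2 fun h => hbZ (h ▸ hz)⟩) p (by omega)
    obtain ⟨d, hd0, hd, hdW, hdb⟩ := exists_nonneg_finset (by omega) hab hg hT W hW hWc
    have hLd := hL d hd0 hd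
    rw [hrep d, hdb, mul_zero, zero_add, Finset.sum_eq_zero] at hLd
    · exact lt_irrefl _ hLd
    · intro z hz
      by_cases h : 0 < μ z
      · rw [hdW z (hZW (Finset.mem_filter.2 ⟨hz, h⟩)), mul_zero]
      · rw [le_antisymm (not_lt.1 h) (hμ z), zero_mul]
  have hle := count_le hN hn hab hg hT c hc0 hcn Z (fun t ht => (hZ t).1 ht)
  have hfe : (Z.filter fun z => 0 < μ z) = Z :=
    Finset.eq_of_subset_of_card_le (Finset.filter_subset _ _) (by omega)
  have hZcard : Z.card = p + 1 := by rw [hfe] at hcardpos; omega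
  have haZ : a ∈ Z := by
    by_contra ha
    have hca : 0 < P g c a := lt_of_le_of_ne (hcn a haI) fun h => ha ((hZ a).2 ⟨haI, h.symm⟩)
    have := count_lt hN hn hab hg hT c hc0 hcn hca hcb Z (fun t ht => (hZ t).1 ht)
    omega
  refine ⟨insert b Z, fun z => if z = b then lam else μ z, ?_, ?_, ?_, ?_, ?_, ?_⟩
  · rw [Finset.card_insert_of_notMem hbZ, hZcard]
  · rw [Finset.coe_insert]
    exact Set.insert_subset hbI hZI
  · exact Finset.mem_insert_of_mem haZ
  · exact Finset.mem_insert_self _ _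
  · intro z hz
    rcases Finset.mem_insert.1 hz with rfl | hz
    · simpa using hlam
    · have hne : z ≠ b := fun h => hbZ (h ▸ hz)
      simp only [hne, if_false]
      rw [← hfe] at hz
      exact (Finset.mem_filter.1 hz).2
  · intro d
    rw [hrep d, Finset.sum_insert hbZ]
    simp only [if_true]
    congr 1
    refine Finset.sum_congr rfl fun z hz => ?_
    have hne : z ≠ b := fun h => hbZ (h ▸ hz)
    simp [hne]

end GLob

/-- Existence of a closed `(n+1)`-point generalised Gauss–Lobatto quadrature
rule, exact for a Tchebyshev system of `2n` continuous functions, with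
positive weights. -/
theorem exists_generalised_gauss_lobatto_quadrature
    (n : ℕ) (hn : 1 ≤ n) (a b : ℝ) (hab : a < b)
    (g : Fin (2 * n) → ℝ → ℝ)
    (hg : ∀ j, ContinuousOn (g j) (Set.Icc a b))
    (hT : IsTchebyshevSystem a b g)
    (ω : ℝ → ℝ) (hω : ContinuousOn ω (Set.Icc a b))
    (hωpos : ∀ x ∈ Set.Icc a b, 0 < ω x) :
    ∃ (x w : Fin (n + 1) → ℝ), x 0 = a ∧ x (Fin.last n) = b ∧ StrictMono x ∧
      (∀ k, 0 < w k) ∧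
      ∀ j, ∫ t in a..b, g j t * ω t = ∑ k, w k * g j (x k) := by
  classical
  let L : (Fin (2 * n) → ℝ) →ₗ[ℝ] ℝ :=
    ∑ j, (∫ t in a..b, g j t * ω t) • LinearMap.proj j
  have hLapp : ∀ c, L c = ∑ j, (∫ t in a..b, g j t * ω t) * c j := fun c => by
    simp [L]
  have hint : ∀ j, IntervalIntegrable (fun t => g j t * ω t) volume a b := fun j =>
    ContinuousOn.intervalIntegrable (by rw [Set.uIcc_of_le hab.le]; exact (hg j).mul hω)
  have hLint : ∀ c, L c = ∫ t in a..b, GLob.P g c t * ω t := by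
    intro c
    rw [hLapp]
    have : ∀ t, GLob.P g c t * ω t = ∑ j, c j * (g j t * ω t) := fun t => by
      simp only [GLob.P, Finset.sum_mul, mul_assoc]
    simp only [this]
    rw [intervalIntegral.integral_finsetSum fun j _ => (hint j).const_mul (c j)]
    refine Finset.sum_congr rfl fun j _ => ?_
    rw [intervalIntegral.integral_const_mul, mul_comm]
  obtain ⟨Z, μ, hZc, hZI, haZ, hbZ, hμ, hrep⟩ := GLob.main_functional rfl hn hab hg hT L (by
    intro c hc0 hc
    rw [hLint]
    obtain ⟨s, hs1, hs2, hs⟩ := GLob.exists_between_pos hT c hc0 hc a b le_rfl le_rfl hab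
    refine intervalIntegral.integral_pos hab ((GLob.P_cont hg c).mul hω) ?_ ?_
    · intro t ht
      have ht' : t ∈ Set.Icc a b := ⟨ht.1.le, ht.2⟩
      exact mul_nonneg (hc t ht') (hωpos t ht').le
    · have hsI : s ∈ Set.Icc a b := ⟨hs1.le, hs2.le⟩
      exact ⟨s, hsI, mul_pos hs (hωpos s hsI)⟩)
  have hx := Z.range_orderEmbOfFin hZc
  have hmono := (Z.orderEmbOfFin hZc).strictMono
  have hmem := Z.orderEmbOfFin_mem hZc
  refine ⟨Z.orderEmbOfFin hZc, fun k => μ (Z.orderEmbOfFin hZc k), ?_, ?_, hmono,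
    fun k => hμ _ (hmem k), ?_⟩
  · have : a ∈ Set.range (Z.orderEmbOfFin hZc) := by rw [hx]; exact haZ
    obtain ⟨i, hi⟩ := this
    refine le_antisymm ?_ (hZI (hmem 0)).1
    calc _ ≤ Z.orderEmbOfFin hZc i := hmono.monotone (Fin.zero_le i)
      _ = a := hi
  · have : b ∈ Set.range (Z.orderEmbOfFin hZc) := by rw [hx]; exact hbZ
    obtain ⟨i, hi⟩ := this
    refine le_antisymm (hZI (hmem _)).2 ?_
    calc b = Z.orderEmbOfFin hZc i := hi.symm
      _ ≤ _ := hmono.monotone (Fin.le_last i)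
  · intro j
    have h := hrep (Pi.single j 1)
    rw [hLapp] at h
    have hP : ∀ t, GLob.P g (Pi.single j 1) t = g j t := fun t => by
      simp [GLob.P, Pi.single_apply]
    simp only [hP] at h
    have h1 : ∑ i, (∫ t in a..b, g i t * ω t) * (Pi.single j (1 : ℝ) : Fin (2 * n) → ℝ) i =
        ∫ t in a..b, g j t * ω t := by
      simp [Pi.single_apply]
    rw [h1] at h
    rw [h]
    conv_lhs => rw [← Z.map_orderEmbOfFin_univ hZc]
    rw [Finset.sum_map]
    rfl
end

section
/- Let n ≥ 1, let a < b, let g_1, …, g_{2n} be continuous real-valued functions forming a Tchebyshev system on [a,b], and let ω be a continuous, strictly positive weight function on [a,b]. Then no closed positive quadrature rule on [a,b] with fewer than n+1 nodes is exact for all of g_1, …, g_{2n} with respect to ω; that is, if a = x_1 < … < x_m = b, all w_k > 0, and ∫_a^b g_j(x)ω(x) dx = Σ_{k=1}^m w_k g_j(x_k) for every j = 1, …, 2n, then m ≥ n+1. -/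
open MeasureTheory

/-- A nontrivial combination of a Tchebyshev system of size `m` cannot vanish at `m` points. -/
lemma tcheb_zero {a b : ℝ} {m : ℕ} {g : Fin m → ℝ → ℝ} (hT : IsTchebyshevSystem a b g)
    (c : Fin m → ℝ) (Z : Finset ℝ) (hZ : Z.card = m) (hZI : ∀ z ∈ Z, z ∈ Set.Icc a b)
    (h0 : ∀ z ∈ Z, ∑ j, c j * g j z = 0) : c = 0 := by
  have hd := hT (Z.orderEmbOfFin hZ) (Z.orderEmbOfFin hZ).strictMono
    (fun i => hZI _ (Z.orderEmbOfFin_mem hZ i))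
  apply Matrix.eq_zero_of_mulVec_eq_zero hd
  funext i
  have := h0 _ (Z.orderEmbOfFin_mem hZ i)
  simp only [Matrix.mulVec, dotProduct, Matrix.of_apply, Pi.zero_apply]
  rw [← this]
  exact Finset.sum_congr rfl fun j _ => mul_comm _ _

/-- A continuous function with zero integral vanishes inside the interval. -/
lemma exists_zero_of_integral_s5 {p q : ℝ} (hpq : p < q) {f : ℝ → ℝ}
    (hf : ContinuousOn f (Set.Icc p q)) (h0 : ∫ t in p..q, f t = 0) :
    ∃ ξ ∈ Set.Ioo p q, f ξ = 0 := by
  have hint : IntervalIntegrable f volume p q := hf.intervalIntegrable_of_Icc hpq.le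
  apply exists_hasDerivAt_eq_zero (f := fun t => ∫ s in p..t, f s) hpq
  · have := intervalIntegral.continuousOn_primitive_interval
      (μ := volume) (f := f) (a := p) (b := q) (by
        rw [Set.uIcc_of_le hpq.le]; exact hf.integrableOn_Icc)
    rwa [Set.uIcc_of_le hpq.le] at this
  · simp [h0]
  · intro t ht
    have hnhds : Set.Icc p q ∈ nhds t := Icc_mem_nhds ht.1 ht.2
    apply intervalIntegral.integral_hasDerivAt_right
    · exact hint.mono_set (by
        rw [Set.uIcc_of_le hpq.le, Set.uIcc_of_le ht.1.le]
        exact Set.Icc_subset_Icc_right ht.2.le)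
    · exact (hf.mono Set.Ioo_subset_Icc_self).stronglyMeasurableAtFilter isOpen_Ioo t ht
    · exact hf.continuousAt hnhds

/-- No closed positive quadrature rule with fewer than `n+1` nodes can be exact
for a Tchebyshev system of `2n` continuous functions. -/
theorem generalised_gauss_lobatto_quadrature_minimal
    (n : ℕ) (hn : 1 ≤ n) (a b : ℝ) (hab : a < b)
    (g : Fin (2 * n) → ℝ → ℝ)
    (hg : ∀ j, ContinuousOn (g j) (Set.Icc a b))
    (hT : IsTchebyshevSystem a b g)
    (ω : ℝ → ℝ) (hω : ContinuousOn ω (Set.Icc a b))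
    (hωpos : ∀ x ∈ Set.Icc a b, 0 < ω x)
    (m : ℕ) (hm : 0 < m) (x w : Fin m → ℝ) (hx : StrictMono x)
    (hxa : x ⟨0, hm⟩ = a) (hxb : x ⟨m - 1, Nat.sub_lt hm Nat.one_pos⟩ = b)
    (hw : ∀ k, 0 < w k)
    (hex : ∀ j, ∫ t in a..b, g j t * ω t = ∑ k, w k * g j (x k)) :
    n + 1 ≤ m := by
  by_contra hmn
  have hxI : ∀ k, x k ∈ Set.Icc a b := fun k => by
    constructor
    · rw [← hxa]; exact hx.monotone (Fin.mk_le_of_le_val (Nat.zero_le _))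
    · rw [← hxb]; exact hx.monotone (by rw [Fin.le_def]; show (k : ℕ) ≤ m - 1; omega)
  have hinf : (Set.Icc a b).Infinite := Set.Icc_infinite hab
  -- extend the nodes to a set of `n` points
  obtain ⟨S, hxS, hSI, hScard⟩ : ∃ S : Finset ℝ, (∀ k, x k ∈ S) ∧ (∀ s ∈ S, s ∈ Set.Icc a b) ∧
      S.card = n := by
    obtain ⟨S, h1, h2, h3⟩ := hinf.exists_superset_ncard_eq (s := Set.range x) (k := n)
      (by rintro _ ⟨k, rfl⟩; exact hxI k) (Set.finite_range x) (by
        rw [← Set.image_univ, Set.ncard_image_of_injective _ hx.injective]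
        simp [Set.ncard_univ]; omega)
    have hfin : S.Finite := Set.finite_of_ncard_pos (by omega)
    refine ⟨hfin.toFinset, fun k => by simpa using h1 ⟨k, rfl⟩, fun s hs => h2 (by simpa using hs), ?_⟩
    rw [← Set.ncard_eq_toFinset_card S hfin, h3]
  obtain ⟨y, hyI, hyS⟩ := hinf.exists_notMem_finset S
  have hTcard : (insert y S).card = n + 1 := by rw [Finset.card_insert_of_notMem hyS, hScard]
  have haS : a ∈ S := hxa ▸ hxS _
  have hbS : b ∈ S := hxb ▸ hxS _
  set z0 := (insert y S).orderEmbOfFin hTcard with hz0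
  have hrange : ∀ s ∈ insert y S, ∃ i, z0 i = s := fun s hs => by
    have : s ∈ Set.range z0 := by rw [hz0, Finset.range_orderEmbOfFin]; exact hs
    exact this
  have hz0I : ∀ i, z0 i ∈ Set.Icc a b := fun i => by
    have := Finset.orderEmbOfFin_mem (insert y S) hTcard i
    rcases Finset.mem_insert.1 this with h | h
    · rw [hz0, h]; exact hyI
    · exact hSI _ h
  let z : ℕ → ℝ := fun i => z0 ⟨min i n, by omega⟩
  have hzmono : Monotone z := fun i j hij => z0.monotone (by rw [Fin.le_def]; show min i n ≤ min j n; omega)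
  have hzlt : ∀ i < n, z i < z (i + 1) := fun i hi =>
    z0.strictMono (by rw [Fin.lt_def]; show min i n < min (i + 1) n; omega)
  have hzI : ∀ i, z i ∈ Set.Icc a b := fun i => hz0I _
  have hzr : ∀ s ∈ S, ∃ i, z i = s := fun s hs => by
    obtain ⟨i, hi⟩ := hrange s (Finset.mem_insert_of_mem hs)
    refine ⟨i, ?_⟩
    rw [← hi]
    show z0 _ = _
    congr 1
    ext
    show min (i : ℕ) n = i
    omega
  have hza : z 0 = a := by
    obtain ⟨i, hi⟩ := hzr a haS
    exact le_antisymm (hi ▸ hzmono (Nat.zero_le i)) (hzI 0).1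
  have hzb : z n = b := by
    obtain ⟨i, hi⟩ := hzr b hbS
    refine le_antisymm (hzI n).2 ?_
    rw [← hi]
    exact z0.monotone (by rw [Fin.le_def]; show min i n ≤ min n n; omega)
  have hgω : ∀ j, ContinuousOn (fun t => g j t * ω t) (Set.Icc a b) := fun j => (hg j).mul hω
  have hgωint : ∀ j p q, p ∈ Set.Icc a b → q ∈ Set.Icc a b →
      IntervalIntegrable (fun t => g j t * ω t) volume p q := fun j p q hp hq =>
    ((hgω j).mono (Set.uIcc_subset_Icc hp hq)).intervalIntegrable
  -- a nontrivial combination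
  let M : Matrix (S ⊕ Fin (n - 1)) (Fin (2 * n)) ℝ := Matrix.of fun r j =>
    Sum.elim (fun s : S => g j s) (fun i : Fin (n - 1) => ∫ t in z i..z (i + 1), g j t * ω t) r
  obtain ⟨c, hcM, hc⟩ : ∃ c, M.mulVec c = 0 ∧ c ≠ 0 := by
    have := LinearMap.ker_ne_bot_of_finrank_lt (f := M.mulVecLin) (by
      simp [hScard]; omega)
    obtain ⟨c, h1, h2⟩ := Submodule.exists_mem_ne_zero_of_ne_bot this
    exact ⟨c, by simpa using h1, h2⟩
  have hu0 : ∀ s ∈ S, ∑ j, c j * g j s = 0 := fun s hs => by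
    have := congrFun hcM (Sum.inl ⟨s, hs⟩)
    simp only [Matrix.mulVec, dotProduct, M, Matrix.of_apply, Sum.elim_inl, Pi.zero_apply] at this
    rw [← this]
    exact Finset.sum_congr rfl fun j _ => mul_comm _ _
  let f : ℝ → ℝ := fun t => ∑ j, c j * (g j t * ω t)
  have hfc : ContinuousOn f (Set.Icc a b) :=
    continuousOn_finsetSum _ fun j _ => continuousOn_const.mul (hgω j)
  have hfint : ∀ p q, p ∈ Set.Icc a b → q ∈ Set.Icc a b →
      ∫ t in p..q, f t = ∑ j, c j * ∫ t in p..q, g j t * ω t := fun p q hp hq => by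
    show ∫ t in p..q, ∑ j, c j * (g j t * ω t) = _
    rw [intervalIntegral.integral_finsetSum fun j _ => (hgωint j p q hp hq).const_mul _]
    simp only [intervalIntegral.integral_const_mul]
  have hgap1 : ∀ i < n - 1, ∫ t in z i..z (i + 1), f t = 0 := fun i hi => by
    have := congrFun hcM (Sum.inr ⟨i, hi⟩)
    simp only [Matrix.mulVec, dotProduct, M, Matrix.of_apply, Sum.elim_inr, Pi.zero_apply] at this
    rw [hfint _ _ (hzI _) (hzI _), ← this]
    exact Finset.sum_congr rfl fun j _ => mul_comm _ _
  have htot : ∫ t in a..b, f t = 0 := by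
    rw [hfint a b ⟨le_rfl, hab.le⟩ ⟨hab.le, le_rfl⟩]
    simp only [hex, Finset.mul_sum]
    rw [Finset.sum_comm]
    refine Finset.sum_eq_zero fun k _ => ?_
    have : ∑ j, c j * (w k * g j (x k)) = w k * ∑ j, c j * g j (x k) := by
      rw [Finset.mul_sum]; exact Finset.sum_congr rfl fun j _ => by ring
    rw [this, hu0 _ (hxS k), mul_zero]
  have hgap : ∀ i < n, ∫ t in z i..z (i + 1), f t = 0 := by
    intro i hi
    by_cases h : i < n - 1
    · exact hgap1 i h
    obtain ⟨k, rfl⟩ : ∃ k, n = k + 1 := ⟨n - 1, by omega⟩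
    have hik : i = k := by omega
    subst hik
    have hs := intervalIntegral.sum_integral_adjacent_intervals (μ := volume) (f := f) (a := z)
      (n := i + 1) (fun j _ => (hfc.mono (Set.uIcc_subset_Icc (hzI _) (hzI _))).intervalIntegrable)
    rw [hza, hzb, htot, Finset.sum_range_succ,
      Finset.sum_eq_zero fun j hj => hgap1 j (by simpa using hj), zero_add] at hs
    exact hs
  have hξ : ∀ i : Fin n, ∃ ξ ∈ Set.Ioo (z i) (z (i + 1)), f ξ = 0 := fun i =>
    exists_zero_of_integral_s5 (hzlt i i.2)
      (hfc.mono (Set.Icc_subset_Icc (hzI _).1 (hzI _).2)) (hgap i i.2)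
  choose ξ hξI hξ0 using hξ
  have hξIcc : ∀ i, ξ i ∈ Set.Icc a b := fun i =>
    ⟨(hzI i).1.trans (hξI i).1.le, (hξI i).2.le.trans (hzI _).2⟩
  have hξmono : StrictMono ξ := fun i j hij =>
    ((hξI i).2.trans_le (hzmono (Nat.succ_le_of_lt hij))).trans (hξI j).1
  have hdisj : Disjoint S (Finset.univ.image ξ) := by
    rw [Finset.disjoint_left]
    intro s hs hs'
    obtain ⟨i, -, hi⟩ := Finset.mem_image.1 hs'
    obtain ⟨j, hj⟩ := hzr s hs
    have h1 := (hξI i).1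
    have h2 := (hξI i).2
    rw [hi, ← hj] at h1 h2
    have h3 := hzmono.reflect_lt h1
    have h4 := hzmono.reflect_lt h2
    omega
  refine hc (tcheb_zero hT c (S ∪ Finset.univ.image ξ) ?_ ?_ ?_)
  · rw [Finset.card_union_of_disjoint hdisj, hScard,
      Finset.card_image_of_injective _ hξmono.injective, Finset.card_fin]
    omega
  · intro s hs
    rcases Finset.mem_union.1 hs with h | h
    · exact hSI s h
    · obtain ⟨i, -, rfl⟩ := Finset.mem_image.1 h
      exact hξIcc i
  · intro s hs
    rcases Finset.mem_union.1 hs with h | h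
    · exact hu0 s h
    · obtain ⟨i, -, rfl⟩ := Finset.mem_image.1 h
      have h1 : (∑ j, c j * g j (ξ i)) * ω (ξ i) = 0 := by
        rw [← hξ0 i, Finset.sum_mul]
        exact Finset.sum_congr rfl fun j _ => by ring
      exact (mul_eq_zero.1 h1).resolve_right (hωpos _ (hξIcc i)).ne'
end

section
/- Let F be a finite-dimensional subspace of C¹[a,b] (a < b) and suppose the space (FF)' := span{(fg)' : f, g ∈ F} is spanned by functions g_1, …, g_{2n} that form a Tchebyshev system on [a,b]. Then there exist closed nodes a = x_0 < x_1 < … < x_n = b and strictly positive weights w_0, …, w_n with Σ_{k=0}^n w_k (fg)'(x_k) = f(b)g(b) − f(a)g(a) for all f, g ∈ F, and if in addition the evaluation map F → ℝ^{n+1}, f ↦ (f(x_0), …, f(x_n)), is injective at these nodes, then a closed diagonal-norm F-based SBP operator of dimension n+1 with these nodes and weights exists. -/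
open Matrix

/-- The boundary matrix `B = diag(-1, 0, …, 0, 1)` of size `(n+1) × (n+1)`. -/
noncomputable def sbpBoundaryMatrix (n : ℕ) : Matrix (Fin (n + 1)) (Fin (n + 1)) ℝ :=
  Matrix.diagonal fun i => (if i = Fin.last n then (1 : ℝ) else 0) + (if i = 0 then -1 else 0)

noncomputable section TchebHelpers

/-- Generalized polynomial with coefficients `c`. -/
def tP {N : ℕ} (g : Fin N → ℝ → ℝ) (c : Fin N → ℝ) (t : ℝ) : ℝ := ∑ j, c j * g j t

theorem tP_add {N : ℕ} (g : Fin N → ℝ → ℝ) (c d : Fin N → ℝ) (t : ℝ) :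
    tP g (c + d) t = tP g c t + tP g d t := by
  simp [tP, add_mul, Finset.sum_add_distrib]

theorem tP_smul {N : ℕ} (g : Fin N → ℝ → ℝ) (r : ℝ) (d : Fin N → ℝ) (t : ℝ) :
    tP g (r • d) t = r * tP g d t := by
  simp [tP, mul_assoc, Finset.mul_sum]

theorem tP_zero {N : ℕ} (g : Fin N → ℝ → ℝ) (t : ℝ) : tP g 0 t = 0 := by
  simp [tP]

theorem tP_continuous {N : ℕ} {g : Fin N → ℝ → ℝ} (hg : ∀ j, Continuous (g j)) (c : Fin N → ℝ) :
    Continuous (tP g c) := by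
  unfold tP
  fun_prop

theorem tP_continuous_coef {N : ℕ} (g : Fin N → ℝ → ℝ) (t : ℝ) :
    Continuous (fun c => tP g c t) := by
  unfold tP
  fun_prop

theorem finset_extend {s : Set ℝ} (hs : s.Infinite) (T : Finset ℝ) (hT : ↑T ⊆ s) {k : ℕ}
    (hk : T.card ≤ k) : ∃ U : Finset ℝ, T ⊆ U ∧ ↑U ⊆ s ∧ U.card = k := by
  have h1 : (s \ ↑T).Infinite := hs.sdiff T.finite_toSet
  obtain ⟨V, hV, hc⟩ := h1.exists_subset_card_eq (k - T.card)
  refine ⟨T ∪ V, Finset.subset_union_left, ?_, ?_⟩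
  · intro x hx
    simp only [Finset.coe_union, Set.mem_union] at hx
    rcases hx with hx | hx
    · exact hT hx
    · exact (hV hx).1
  · rw [Finset.card_union_of_disjoint, hc]
    · omega
    · rw [Finset.disjoint_left]
      intro x hx hx'
      exact (hV hx').2 hx

theorem tP_eq_zero {a b : ℝ} {N : ℕ} {g : Fin N → ℝ → ℝ} (hT : IsTchebyshevSystem a b g)
    (c : Fin N → ℝ) (T : Finset ℝ) (hc : T.card = N) (hTI : ∀ t ∈ T, t ∈ Set.Icc a b)
    (h0 : ∀ t ∈ T, tP g c t = 0) : c = 0 := by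
  have h := hT (T.orderEmbOfFin hc) (T.orderEmbOfFin hc).strictMono
    (fun i => hTI _ (T.orderEmbOfFin_mem hc i))
  apply Matrix.eq_zero_of_mulVec_eq_zero h
  ext i
  have := h0 _ (T.orderEmbOfFin_mem hc i)
  simpa [Matrix.mulVec, dotProduct, tP, mul_comm] using this

theorem tP_interp {a b : ℝ} (hab : a < b) {N : ℕ} {g : Fin N → ℝ → ℝ}
    (hT : IsTchebyshevSystem a b g) (T : Finset ℝ) (hc : T.card ≤ N)
    (hTI : ∀ t ∈ T, t ∈ Set.Icc a b) (v : ℝ → ℝ) : ∃ c, ∀ t ∈ T, tP g c t = v t := by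
  obtain ⟨U, hTU, hU, hcU⟩ := finset_extend (Set.Icc_infinite hab) T hTI hc
  have h := hT (U.orderEmbOfFin hcU) (U.orderEmbOfFin hcU).strictMono
    (fun i => hU (U.orderEmbOfFin_mem hcU i))
  set M := (Matrix.of fun i j => g j (U.orderEmbOfFin hcU i)) with hM
  have hu : IsUnit M.det := isUnit_iff_ne_zero.mpr h
  refine ⟨M⁻¹ *ᵥ (fun i => v (U.orderEmbOfFin hcU i)), fun t ht => ?_⟩
  have : t ∈ Set.range (U.orderEmbOfFin hcU) := by
    rw [Finset.range_orderEmbOfFin]; exact hTU ht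
  obtain ⟨i, rfl⟩ := this
  have h2 : M *ᵥ (M⁻¹ *ᵥ (fun i => v (U.orderEmbOfFin hcU i))) =
      fun i => v (U.orderEmbOfFin hcU i) := by
    rw [Matrix.mulVec_mulVec, Matrix.mul_nonsing_inv _ hu, Matrix.one_mulVec]
  have h3 := congrFun h2 i
  rw [← h3]
  simp only [tP, Matrix.mulVec, dotProduct, mul_comm]
  rfl

theorem tP_zeros {a b : ℝ} {N : ℕ} {g : Fin N → ℝ → ℝ} (hT : IsTchebyshevSystem a b g)
    (c : Fin N → ℝ) (hc : c ≠ 0) :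
    ∃ Z : Finset ℝ, Z.card ≤ N ∧ ∀ t, t ∈ Z ↔ t ∈ Set.Icc a b ∧ tP g c t = 0 := by
  have hfin : {t | t ∈ Set.Icc a b ∧ tP g c t = 0}.Finite := by
    by_contra hinf
    obtain ⟨T, hTs, hTc⟩ := Set.Infinite.exists_subset_card_eq hinf N
    exact hc (tP_eq_zero hT c T hTc (fun t ht => (hTs ht).1) (fun t ht => (hTs ht).2))
  refine ⟨hfin.toFinset, ?_, fun t => by simp⟩
  by_contra hlt
  obtain ⟨T, hTs, hTc⟩ := Finset.exists_subset_card_eq (not_le.mp hlt).le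
  have hm : ∀ t ∈ T, t ∈ Set.Icc a b ∧ tP g c t = 0 := fun t ht => by simpa using hTs ht
  exact hc (tP_eq_zero hT c T hTc (fun t ht => (hm t ht).1) (fun t ht => (hm t ht).2))

/-- perturbation -/
theorem perturb {a b : ℝ} {p q : ℝ → ℝ} (hp : Continuous p)
    (hq : Continuous q) (hp0 : ∀ t ∈ Set.Icc a b, 0 ≤ p t)
    (hpq : ∀ t ∈ Set.Icc a b, p t = 0 → 0 < q t) :
    ∃ ε > 0, ∀ t ∈ Set.Icc a b, 0 ≤ p t + ε * q t := by
  have hK : IsCompact (Set.Icc a b ∩ {t | q t ≤ 0}) :=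
    isCompact_Icc.inter_right (isClosed_le hq continuous_const)
  rcases Set.eq_empty_or_nonempty (Set.Icc a b ∩ {t | q t ≤ 0}) with he | hne
  · refine ⟨1, one_pos, fun t ht => ?_⟩
    have : ¬ q t ≤ 0 := fun h => by
      have : t ∈ Set.Icc a b ∩ {t | q t ≤ 0} := ⟨ht, h⟩
      rw [he] at this; exact this
    have := hp0 t ht
    linarith
  · obtain ⟨t0, ht0, hmin⟩ := hK.exists_isMinOn hne hp.continuousOn
    obtain ⟨t1, ht1, hmin1⟩ := hK.exists_isMinOn hne hq.continuousOn
    have hpos : 0 < p t0 := by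
      rcases (hp0 t0 ht0.1).lt_or_eq with h | h
      · exact h
      · have := hpq t0 ht0.1 h.symm
        have h2 : q t0 ≤ 0 := ht0.2
        linarith
    have hq1 : q t1 ≤ 0 := ht1.2
    have hd : 0 < 1 - q t1 := by linarith
    refine ⟨p t0 / (1 - q t1), div_pos hpos hd, fun t ht => ?_⟩
    have hε := div_pos hpos hd
    by_cases hqt : q t ≤ 0
    · have h1 : p t0 ≤ p t := hmin ⟨ht, hqt⟩
      have h2 : q t1 ≤ q t := hmin1 ⟨ht, hqt⟩
      have h3 : p t0 / (1 - q t1) * (1 - q t1) = p t0 := div_mul_cancel₀ _ hd.ne'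
      nlinarith
    · have := hp0 t ht
      have := mul_pos hε (not_le.mp hqt)
      linarith

/-- a nonzero nonnegative polynomial cannot have `n` interior zeros when `N = 2n`. -/
theorem no_n_interior {a b : ℝ} {n N : ℕ} (hN : N = 2 * n) (hn : 1 ≤ n)
    (hab : a < b) {g : Fin N → ℝ → ℝ} (hg : ∀ j, Continuous (g j))
    (hT : IsTchebyshevSystem a b g) (c : Fin N → ℝ) (hc : c ≠ 0)
    (hpos : ∀ t ∈ Set.Icc a b, 0 ≤ tP g c t) (T : Finset ℝ) (hTc : T.card = n)
    (hTI : ∀ t ∈ T, t ∈ Set.Ioo a b) (hT0 : ∀ t ∈ T, tP g c t = 0) : False := by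
  obtain ⟨Z, -, hZ⟩ := tP_zeros hT c hc
  obtain ⟨q, hq⟩ := tP_interp hab hT T (by omega)
    (fun t ht => Set.Ioo_subset_Icc_self (hTI t ht)) (fun _ => -1)
  -- choose δ
  have hδ : ∀ᶠ δ in nhdsWithin (0 : ℝ) (Set.Ioi 0), 0 < δ ∧ ∀ z ∈ T, (a < z - δ ∧ z + δ < b) ∧
      (z - δ ∉ Z ∧ z + δ ∉ Z) ∧ ∀ z' ∈ T, z < z' → z + δ < z' - δ := by
    refine (eventually_mem_nhdsWithin.mono fun _ h => h).and ?_
    have hid : Filter.Tendsto (fun δ : ℝ => δ) (nhdsWithin (0 : ℝ) (Set.Ioi 0)) (nhds 0) :=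
      nhdsWithin_le_nhds
    have hsmall : ∀ r : ℝ, 0 < r → ∀ᶠ δ in nhdsWithin (0 : ℝ) (Set.Ioi 0), δ < r :=
      fun r hr => hid.eventually (gt_mem_nhds hr)
    have hne : ∀ r : ℝ, ∀ᶠ δ in nhdsWithin (0 : ℝ) (Set.Ioi 0), δ ≠ r := by
      intro r
      rcases lt_or_ge 0 r with h | h
      · exact (hsmall r h).mono fun _ h => h.ne
      · exact (eventually_mem_nhdsWithin).mono fun x hx => (lt_of_le_of_lt h hx).ne'
    rw [Filter.eventually_all_finset]
    intro z hz
    refine Filter.Eventually.and ?_ (Filter.Eventually.and (Filter.Eventually.and ?_ ?_) ?_)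
    · filter_upwards [hsmall (z - a) (by linarith [(hTI z hz).1]),
        hsmall (b - z) (by linarith [(hTI z hz).2])] with δ h1 h2
      constructor <;> linarith
    · have : ∀ᶠ δ in nhdsWithin (0 : ℝ) (Set.Ioi 0), ∀ y ∈ Z, δ ≠ z - y := by
        rw [Filter.eventually_all_finset]
        intro y _
        exact hne _
      filter_upwards [this] with δ h hmem
      exact h _ hmem (by ring)
    · have : ∀ᶠ δ in nhdsWithin (0 : ℝ) (Set.Ioi 0), ∀ y ∈ Z, δ ≠ y - z := by
        rw [Filter.eventually_all_finset]
        intro y _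
        exact hne _
      filter_upwards [this] with δ h hmem
      exact h _ hmem (by ring)
    · rw [Filter.eventually_all_finset]
      intro z' _
      by_cases hlt : z < z'
      · filter_upwards [hsmall ((z' - z) / 2) (by linarith)] with δ h _
        linarith
      · exact Filter.Eventually.of_forall fun _ h => absurd h hlt
  obtain ⟨δ, hδ0, hδ⟩ := hδ.exists
  have hppos : ∀ t ∈ Set.Icc a b, t ∉ Z → 0 < tP g c t := by
    intro t ht htZ
    refine lt_of_le_of_ne (hpos t ht) fun h => htZ ((hZ t).2 ⟨ht, h.symm⟩)
  have hε : ∀ᶠ ε in nhdsWithin (0 : ℝ) (Set.Ioi 0), 0 < ε ∧ ∀ z ∈ T,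
      0 < tP g c (z - δ) + ε * tP g q (z - δ) ∧ 0 < tP g c (z + δ) + ε * tP g q (z + δ) := by
    refine (eventually_mem_nhdsWithin.mono fun _ h => h).and ?_
    rw [Filter.eventually_all_finset]
    intro z hz
    have hmain : ∀ t ∈ Set.Icc a b, t ∉ Z → ∀ᶠ ε in nhdsWithin (0 : ℝ) (Set.Ioi 0),
        0 < tP g c t + ε * tP g q t := by
      intro t ht htZ
      have h1 := hppos t ht htZ
      have : Filter.Tendsto (fun ε : ℝ => tP g c t + ε * tP g q t) (nhds 0)
          (nhds (tP g c t + 0 * tP g q t)) := by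
        apply Continuous.tendsto; fun_prop
      exact (nhdsWithin_le_nhds) (this.eventually (lt_mem_nhds (by simpa using h1)))
    obtain ⟨⟨h1, h2⟩, ⟨h3, h4⟩, -⟩ := hδ z hz
    have := hTI z hz
    exact (hmain _ ⟨h1.le, by linarith [this.2]⟩ h3).and
      (hmain _ ⟨by linarith [this.1], h2.le⟩ h4)
  obtain ⟨ε, hε0, hε⟩ := hε.exists
  set d := c + ε • q with hd
  have hdt : ∀ t, tP g d t = tP g c t + ε * tP g q t := fun t => by
    rw [hd, tP_add, tP_smul]
  have hdc : Continuous (tP g d) := tP_continuous hg d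
  have hneg : ∀ z ∈ T, tP g d z < 0 := fun z hz => by
    rw [hdt, hT0 z hz, hq z hz]; linarith
  have hL : ∀ z ∈ T, ∃ y, y ∈ Set.Ioo (z - δ) z ∧ tP g d y = 0 := by
    intro z hz
    have h1 := intermediate_value_Ioo' (show z - δ ≤ z by linarith)
      (hdc.continuousOn (s := Set.Icc (z - δ) z))
    obtain ⟨y, hy, hy0⟩ := h1 ⟨hneg z hz, by rw [hdt]; exact (hε z hz).1⟩
    exact ⟨y, hy, hy0⟩
  have hR : ∀ z ∈ T, ∃ y, y ∈ Set.Ioo z (z + δ) ∧ tP g d y = 0 := by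
    intro z hz
    have h1 := intermediate_value_Ioo (show z ≤ z + δ by linarith)
      (hdc.continuousOn (s := Set.Icc z (z + δ)))
    obtain ⟨y, hy, hy0⟩ := h1 ⟨hneg z hz, by rw [hdt]; exact (hε z hz).2⟩
    exact ⟨y, hy, hy0⟩
  choose! yl hyl hyl0 using hL
  choose! yr hyr hyr0 using hR
  have hinjl : Set.InjOn yl T := by
    intro z hz z' hz' h
    have h1 := hyl z hz
    have h2 := hyl z' hz'
    rw [← h] at h2
    rcases lt_trichotomy z z' with hlt | heq | hlt
    · have := (hδ z hz).2.2 z' hz' hlt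
      linarith [h1.1, h1.2, h2.1, h2.2]
    · exact heq
    · have := (hδ z' hz').2.2 z hz hlt
      linarith [h1.1, h1.2, h2.1, h2.2]
  have hinjr : Set.InjOn yr T := by
    intro z hz z' hz' h
    have h1 := hyr z hz
    have h2 := hyr z' hz'
    rw [← h] at h2
    rcases lt_trichotomy z z' with hlt | heq | hlt
    · have := (hδ z hz).2.2 z' hz' hlt
      linarith [h1.1, h1.2, h2.1, h2.2]
    · exact heq
    · have := (hδ z' hz').2.2 z hz hlt
      linarith [h1.1, h1.2, h2.1, h2.2]
  have hdisj : Disjoint (T.image yl) (T.image yr) := by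
    rw [Finset.disjoint_left]
    intro y h1 h2
    obtain ⟨z, hz, rfl⟩ := Finset.mem_image.1 h1
    obtain ⟨z', hz', h⟩ := Finset.mem_image.1 h2
    have h1 := hyl z hz
    have h2 := hyr z' hz'
    rw [h] at h2
    rcases lt_trichotomy z z' with hlt | heq | hlt
    · linarith [h1.1, h1.2, h2.1, h2.2]
    · subst heq
      linarith [h1.1, h1.2, h2.1, h2.2]
    · have := (hδ z' hz').2.2 z hz hlt
      linarith [h1.1, h1.2, h2.1, h2.2]
  have hd0 : d = 0 := by
    apply tP_eq_zero hT d (T.image yl ∪ T.image yr)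
    · rw [Finset.card_union_of_disjoint hdisj, Finset.card_image_of_injOn hinjl,
        Finset.card_image_of_injOn hinjr]
      omega
    · intro t ht
      rcases Finset.mem_union.1 ht with h | h
      · obtain ⟨z, hz, rfl⟩ := Finset.mem_image.1 h
        have h1 := hyl z hz
        have h2 := (hδ z hz).1
        exact ⟨by linarith [h1.1], by linarith [h1.2]⟩
      · obtain ⟨z, hz, rfl⟩ := Finset.mem_image.1 h
        have h1 := hyr z hz
        have h2 := (hδ z hz).1
        exact ⟨by linarith [h1.1], by linarith [h1.2]⟩
    · intro t ht
      rcases Finset.mem_union.1 ht with h | h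
      · obtain ⟨z, hz, rfl⟩ := Finset.mem_image.1 h
        exact hyl0 z hz
      · obtain ⟨z, hz, rfl⟩ := Finset.mem_image.1 h
        exact hyr0 z hz
  obtain ⟨z, hz⟩ := Finset.card_pos.1 (by omega : 0 < T.card)
  have := hneg z hz
  rw [hd0, tP_zero] at this
  exact lt_irrefl _ this

/-- the determinant as a function of the points -/
def tD {N : ℕ} (g : Fin N → ℝ → ℝ) (y : Fin N → ℝ) : ℝ := (Matrix.of fun i j => g j (y i)).det

theorem tD_sign {a b : ℝ} {N : ℕ} {g : Fin N → ℝ → ℝ} (hg : ∀ j, Continuous (g j))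
    (hT : IsTchebyshevSystem a b g) :
    ∃ σ : ℝ, ∀ y : Fin N → ℝ, StrictMono y → (∀ i, y i ∈ Set.Icc a b) → 0 < σ * tD g y := by
  set X : Set (Fin N → ℝ) := {y | StrictMono y ∧ ∀ i, y i ∈ Set.Icc a b} with hX
  have hconv : Convex ℝ X := by
    intro y hy z hz s t hs ht hst
    refine ⟨fun i j hij => ?_, fun i => ?_⟩
    · have h1 := hy.1 hij
      have h2 := hz.1 hij
      simp only [Pi.add_apply, Pi.smul_apply, smul_eq_mul]
      rcases hs.lt_or_eq with h | h
      · nlinarith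
      · subst h
        have : t = 1 := by linarith
        subst this
        linarith
    · exact (convex_Icc a b) (hy.2 i) (hz.2 i) hs ht hst
  have hcont : Continuous (tD g) := by
    unfold tD
    apply Continuous.matrix_det
    apply continuous_matrix
    intro i j
    exact (hg j).comp (continuous_apply i)
  have hpre := hconv.isPreconnected.image (tD g) hcont.continuousOn
  have hord := hpre.ordConnected
  have hne : (0 : ℝ) ∉ tD g '' X := by
    rintro ⟨y, hy, h0⟩
    exact hT y hy.1 hy.2 h0
  by_cases hemp : X.Nonempty
  · obtain ⟨y0, hy0⟩ := hemp
    refine ⟨tD g y0, fun y hy hyI => ?_⟩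
    have hyX : y ∈ X := ⟨hy, hyI⟩
    by_contra hcon
    rw [not_lt, mul_nonpos_iff] at hcon
    rcases hcon with ⟨h1, h2⟩ | ⟨h1, h2⟩
    · exact hne (hord.out ⟨y, hyX, rfl⟩ ⟨y0, hy0, rfl⟩ ⟨h2, h1⟩)
    · exact hne (hord.out ⟨y0, hy0, rfl⟩ ⟨y, hyX, rfl⟩ ⟨h1, h2⟩)
  · exact ⟨1, fun y hy hyI => absurd ⟨y, hy, hyI⟩ hemp⟩

theorem tD_insert {k : ℕ} (g : Fin (k + 1) → ℝ → ℝ) (y : Fin k → ℝ) (t : ℝ) (p : Fin (k + 1))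
    (hp : Even (p : ℕ)) :
    tD g (Fin.cons t y : Fin (k + 1) → ℝ) = tD g (p.insertNth t y : Fin (k + 1) → ℝ) := by
  have h := Matrix.det_permute p.cycleRange
    (Matrix.of fun i j => g j ((Fin.cons t y : Fin (k + 1) → ℝ) i))
  rw [Fin.sign_cycleRange, hp.neg_one_pow] at h
  simp only [Units.val_one, Int.cast_one, one_mul] at h
  unfold tD
  rw [← h]
  congr 1
  ext i j
  simp only [Matrix.submatrix_apply, Matrix.of_apply, id]
  rw [Fin.cons_apply_cycleRange]

theorem tD_poly {k : ℕ} (g : Fin (k + 1) → ℝ → ℝ) (y : Fin k → ℝ) (σ : ℝ) :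
    ∃ c, ∀ t, tP g c t = σ * tD g (Fin.cons t y : Fin (k + 1) → ℝ) := by
  refine ⟨fun j => σ * ((-1) ^ (j : ℕ) *
    (Matrix.of fun (i : Fin k) (l : Fin k) => g (j.succAbove l) (y i)).det), fun t => ?_⟩
  unfold tD tP
  rw [Matrix.det_succ_row_zero, Finset.mul_sum]
  refine Finset.sum_congr rfl fun j _ => ?_
  have : (Matrix.of fun (i : Fin (k+1)) j => g j ((Fin.cons t y : Fin (k + 1) → ℝ) i)).submatrix
      Fin.succ j.succAbove = Matrix.of fun (i : Fin k) (l : Fin k) => g (j.succAbove l) (y i) := by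
    ext i l
    simp
  rw [this]
  simp
  ring

/-- Nonnegative polynomial with prescribed zeros `S ∪ {b}`. -/
theorem exists_nonneg_poly {a b : ℝ} (hab : a < b) {m N : ℕ} (hN : N = 2 * m + 1 + 1)
    {g : Fin N → ℝ → ℝ} (hg : ∀ j, Continuous (g j)) (hT : IsTchebyshevSystem a b g)
    (S : Finset ℝ) (hS : S.card = m) (hSI : ∀ t ∈ S, t ∈ Set.Ico a b) :
    ∃ c : Fin N → ℝ, c ≠ 0 ∧ (∀ t ∈ Set.Icc a b, 0 ≤ tP g c t) ∧
      (∀ t ∈ S, tP g c t = 0) ∧ tP g c b = 0 := by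
  subst hN
  obtain ⟨σ, hσ⟩ := tD_sign hg hT
  obtain ⟨z, hz⟩ : ∃ z : ℕ → ℝ, z = fun i => if h : i < m then S.orderEmbOfFin hS ⟨i, h⟩ else b :=
    ⟨_, rfl⟩
  have hzlt : ∀ i, i < m → z i ∈ S := by
    intro i hi
    simp only [hz, hi, dif_pos]
    exact S.orderEmbOfFin_mem hS _
  have hzm : z m = b := by simp [hz]
  have hmono : ∀ i j, i < j → j ≤ m → z i < z j := by
    intro i j hij hj
    rcases hj.lt_or_eq with h | h
    · simp only [hz, h, hij.trans h, dif_pos]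
      exact (S.orderEmbOfFin hS).strictMono (by simpa using hij)
    · subst h
      rw [hzm]
      exact (hSI _ (hzlt i hij)).2
  have hzI : ∀ i ≤ m, z i ∈ Set.Icc a b := by
    intro i hi
    rcases hi.lt_or_eq with h | h
    · exact Set.Ico_subset_Icc_self (hSI _ (hzlt i h))
    · rw [h, hzm]; exact ⟨hab.le, le_rfl⟩
  have hSz : ∀ t ∈ S, ∃ i < m, z i = t := by
    intro t ht
    have : t ∈ Set.range (S.orderEmbOfFin hS) := by
      rw [Finset.range_orderEmbOfFin]; exact ht
    obtain ⟨i, rfl⟩ := this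
    exact ⟨i, i.2, by simp [hz]⟩
  set y : ℝ → Fin (2 * m + 1) → ℝ := fun ε j => z ((j : ℕ) / 2) + (((j : ℕ) % 2 : ℕ) : ℝ) * ε with hy
  choose C hC using fun ε => tD_poly g (y ε) σ
  set 𝓕 := nhdsWithin (0 : ℝ) (Set.Ioi 0) with hF
  have hsmall : ∀ r : ℝ, 0 < r → ∀ᶠ δ in 𝓕, δ < r := fun r hr =>
    (show Filter.Tendsto (fun δ : ℝ => δ) 𝓕 (nhds 0) from nhdsWithin_le_nhds).eventually
      (gt_mem_nhds hr)
  have hgap : ∀ᶠ ε in 𝓕, 0 < ε ∧ ∀ i ∈ Finset.range m, ε < z (i + 1) - z i := by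
    refine (eventually_mem_nhdsWithin.mono fun _ h => h).and ?_
    rw [Filter.eventually_all_finset]
    intro i hi
    have := Finset.mem_range.1 hi
    exact hsmall _ (by linarith [hmono i (i + 1) (by omega) (by omega)])
  -- y is admissible
  have hyle : ∀ ε, 0 < ε → ∀ j : Fin (2 * m + 1), z ((j : ℕ) / 2) ≤ y ε j ∧
      y ε j ≤ z ((j : ℕ) / 2) + ε := by
    intro ε hε j
    simp only [hy]
    rcases Nat.mod_two_eq_zero_or_one (j : ℕ) with h | h <;> rw [h] <;> simp [hε.le]
  have hymono : ∀ ε, (0 < ε ∧ ∀ i ∈ Finset.range m, ε < z (i + 1) - z i) → StrictMono (y ε) := by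
    intro ε hε
    have key : ∀ i j : Fin (2 * m + 1), i < j → y ε i < y ε j := by
      intro i j hij
      have hij' : (i : ℕ) < j := hij
      have hj := j.2
      rcases (Nat.div_le_div_right hij'.le : (i : ℕ) / 2 ≤ (j : ℕ) / 2).lt_or_eq with h | h
      · have h1 := (hyle ε hε.1 i).2
        have h2 := (hyle ε hε.1 j).1
        have h3 := hε.2 ((i : ℕ) / 2) (Finset.mem_range.2 (by omega))
        have h4 : z ((i : ℕ) / 2 + 1) ≤ z ((j : ℕ) / 2) := by
          rcases (Nat.succ_le_of_lt h).lt_or_eq with h' | h'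
          · exact (hmono _ _ h' (by omega)).le
          · rw [← h']
        linarith
      · have hi0 : (i : ℕ) % 2 = 0 := by omega
        have hj0 : (j : ℕ) % 2 = 1 := by omega
        simp only [hy, hi0, hj0, h]
        simp [hε.1]
    exact fun i j h => key i j h
  have hyI : ∀ ε, (0 < ε ∧ ∀ i ∈ Finset.range m, ε < z (i + 1) - z i) →
      ∀ j, y ε j ∈ Set.Icc a b := by
    intro ε hε j
    have hj := j.2
    refine ⟨(hzI _ (by omega)).1.trans (hyle ε hε.1 j).1, ?_⟩
    have hl : y ε j ≤ y ε (Fin.last _) := (hymono ε hε).monotone (Fin.le_last j)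
    refine hl.trans ?_
    simp [hy, hzm]
  -- core positivity
  have hcore : ∀ t ∈ Set.Icc a b, (∀ i ≤ m, t ≠ z i) → ∀ᶠ ε in 𝓕, 0 < tP g (C ε) t := by
    intro t ht htz
    have hex : ∃ k, t < z k := ⟨m, lt_of_le_of_ne (hzm ▸ ht.2) (htz m le_rfl)⟩
    classical
    set k := Nat.find hex with hk
    have hkm : k ≤ m := Nat.find_min' hex (lt_of_le_of_ne (hzm ▸ ht.2) (htz m le_rfl))
    have hk1 : t < z k := Nat.find_spec hex
    have hk2 : ∀ i < k, z i < t := by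
      intro i hi
      have := Nat.find_min hex hi
      exact lt_of_le_of_ne (not_lt.1 this) (htz i (by omega)).symm
    have hsm : ∀ᶠ ε in 𝓕, ∀ i ∈ Finset.range k, ε < t - z i := by
      rw [Filter.eventually_all_finset]
      intro i hi
      exact hsmall _ (by linarith [hk2 i (Finset.mem_range.1 hi)])
    filter_upwards [hgap, hsm] with ε hε hε2
    rw [hC, tD_insert g (y ε) t ⟨2 * k, by omega⟩ (by simp)]
    apply hσ
    · rw [Fin.strictMono_insertNth_iff]
      refine ⟨hymono ε hε, fun i hi => ?_, fun i hi => ?_⟩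
      · have hi' : (i : ℕ) < 2 * k := hi
        have h1 := hε2 ((i : ℕ) / 2) (Finset.mem_range.2 (by omega))
        linarith [(hyle ε hε.1 i).2]
      · have hi' : 2 * k ≤ (i : ℕ) := hi
        have hi2 := i.2
        have h1 : z k ≤ z ((i : ℕ) / 2) := by
          rcases (show k ≤ (i : ℕ) / 2 by omega).lt_or_eq with h' | h'
          · exact (hmono _ _ h' (by omega)).le
          · rw [← h']
        linarith [(hyle ε hε.1 i).1]
    · intro i
      cases i using Fin.succAboveCases (⟨2 * k, by omega⟩ : Fin (2 * m + 1 + 1)) with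
      | x => simpa using ht
      | p j => simpa using hyI ε hε j
  have hzero : ∀ ε, ∀ i ≤ m, tP g (C ε) (z i) = 0 := by
    intro ε i hi
    rw [hC]
    have : tD g (Fin.cons (z i) (y ε) : Fin (2 * m + 1 + 1) → ℝ) = 0 := by
      unfold tD
      apply Matrix.det_zero_of_row_eq (i := 0) (j := Fin.succ ⟨2 * i, by omega⟩)
        (Fin.succ_ne_zero _).symm
      ext j
      simp only [Matrix.of_apply, Fin.cons_zero, Fin.cons_succ]
      simp [hy]
    rw [this, mul_zero]
  -- nonzero
  have hCne : ∀ᶠ ε in 𝓕, C ε ≠ 0 := by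
    obtain ⟨t, htI, ht⟩ := (Set.Icc_infinite hab).exists_notMem_finset ((Finset.range (m + 1)).image z)
    have := hcore t htI (fun i hi h => ht (Finset.mem_image.2
      ⟨i, Finset.mem_range.2 (by omega), h.symm⟩))
    filter_upwards [this] with ε hε h0
    rw [h0, tP_zero] at hε
    exact lt_irrefl _ hε
  have : 𝓕.NeBot := by rw [hF]; infer_instance
  set U := Ultrafilter.of 𝓕 with hU
  have hUF : (U : Filter ℝ) ≤ 𝓕 := Ultrafilter.of_le 𝓕
  set u : ℝ → (Fin (2 * m + 1 + 1) → ℝ) := fun ε => (‖C ε‖)⁻¹ • C ε with hu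
  have hsph : ∀ᶠ ε in (U : Filter ℝ), u ε ∈ Metric.sphere (0 : Fin (2 * m + 1 + 1) → ℝ) 1 := by
    filter_upwards [hUF hCne] with ε hε
    have : ‖C ε‖ ≠ 0 := norm_ne_zero_iff.2 hε
    simp [hu, norm_smul, this]
  have hcomp := isCompact_sphere (0 : Fin (2 * m + 1 + 1) → ℝ) 1
  obtain ⟨c, hcs, hcl⟩ := (isCompact_iff_ultrafilter_le_nhds.1 hcomp) (U.map u)
    (by rw [Filter.le_principal_iff]; exact hsph)
  have htend : Filter.Tendsto u U (nhds c) := hcl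
  have htt : ∀ t, Filter.Tendsto (fun ε => tP g (u ε) t) U (nhds (tP g c t)) := fun t =>
    ((tP_continuous_coef g t).tendsto c).comp htend
  have hc0 : ∀ i ≤ m, tP g c (z i) = 0 := by
    intro i hi
    refine tendsto_nhds_unique (htt (z i)) ?_
    have : (fun ε => tP g (u ε) (z i)) = fun _ => 0 := by
      funext ε
      simp only [hu]
      rw [tP_smul, hzero ε i hi, mul_zero]
    rw [this]
    exact tendsto_const_nhds
  refine ⟨c, ?_, ?_, ?_, ?_⟩
  · rintro rfl
    simp at hcs
  · intro t ht
    by_cases h : ∀ i ≤ m, t ≠ z i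
    · refine ge_of_tendsto (htt t) ?_
      filter_upwards [hUF (hcore t ht h)] with ε hε
      simp only [hu]
      rw [tP_smul]
      exact mul_nonneg (by positivity) hε.le
    · push Not at h
      obtain ⟨i, hi, rfl⟩ := h
      exact (hc0 i hi).ge
  · intro t ht
    obtain ⟨i, hi, rfl⟩ := hSz t ht
    exact hc0 i hi.le
  · rw [← hzm]
    exact hc0 m le_rfl

/-- The integral functional on coefficient vectors. -/
def tL (a b : ℝ) {N : ℕ} (g : Fin N → ℝ → ℝ) (c : Fin N → ℝ) : ℝ := ∫ t in a..b, tP g c t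

theorem tL_add {a b : ℝ} {N : ℕ} {g : Fin N → ℝ → ℝ} (hg : ∀ j, Continuous (g j))
    (c d : Fin N → ℝ) : tL a b g (c + d) = tL a b g c + tL a b g d := by
  unfold tL
  simp only [tP_add]
  exact intervalIntegral.integral_add ((tP_continuous hg c).intervalIntegrable _ _)
    ((tP_continuous hg d).intervalIntegrable _ _)

theorem tL_smul {a b : ℝ} {N : ℕ} {g : Fin N → ℝ → ℝ}
    (r : ℝ) (d : Fin N → ℝ) : tL a b g (r • d) = r * tL a b g d := by
  unfold tL
  simp only [tP_smul]
  exact intervalIntegral.integral_const_mul _ _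

/-- The functional as a linear map. -/
def tLlin (a b : ℝ) {N : ℕ} (g : Fin N → ℝ → ℝ) (hg : ∀ j, Continuous (g j)) :
    (Fin N → ℝ) →ₗ[ℝ] ℝ where
  toFun := tL a b g
  map_add' := tL_add hg
  map_smul' r d := by simp [tL_smul]

/-- Evaluation as a linear map. -/
def tPlin {N : ℕ} (g : Fin N → ℝ → ℝ) (t : ℝ) : (Fin N → ℝ) →ₗ[ℝ] ℝ where
  toFun c := tP g c t
  map_add' c d := tP_add g c d t
  map_smul' r d := by simp [tP_smul]

theorem tL_pos {a b : ℝ} (hab : a < b) {N : ℕ} {g : Fin N → ℝ → ℝ} (hg : ∀ j, Continuous (g j))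
    (hT : IsTchebyshevSystem a b g) (c : Fin N → ℝ) (hc : c ≠ 0)
    (hpos : ∀ t ∈ Set.Icc a b, 0 ≤ tP g c t) : 0 < tL a b g c := by
  obtain ⟨Z, -, hZ⟩ := tP_zeros hT c hc
  obtain ⟨t, htI, ht⟩ := (Set.Icc_infinite hab).exists_notMem_finset Z
  refine intervalIntegral.integral_pos hab (tP_continuous hg c).continuousOn
    (fun x hx => hpos x (Set.Ioc_subset_Icc_self hx)) ⟨t, htI, ?_⟩
  exact lt_of_le_of_ne (hpos t htI) fun h => ht ((hZ t).2 ⟨htI, h.symm⟩)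

/-- Nonneg functional on values at finitely many interpolable points. -/
theorem farkas_interp {a b : ℝ} (hab : a < b) {N : ℕ} {g : Fin N → ℝ → ℝ}
    (hT : IsTchebyshevSystem a b g) (Z : Finset ℝ) (hZc : Z.card ≤ N)
    (hZI : ∀ t ∈ Z, t ∈ Set.Icc a b) (M : (Fin N → ℝ) →ₗ[ℝ] ℝ)
    (hM : ∀ q, (∀ t ∈ Z, 0 < tP g q t) → 0 ≤ M q) :
    ∃ w : ℝ → ℝ, (∀ z ∈ Z, 0 ≤ w z) ∧ ∀ q, M q = ∑ z ∈ Z, w z * tP g q z := by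
  classical
  obtain ⟨r, hr⟩ := tP_interp hab hT Z hZc hZI (fun _ => 1)
  have hM' : ∀ q, (∀ t ∈ Z, 0 ≤ tP g q t) → 0 ≤ M q := by
    intro q hq
    by_contra hneg
    rw [not_le] at hneg
    have hd : 0 < 1 + |M r| := by positivity
    set δ := -(M q) / (2 * (1 + |M r|)) with hδ
    have hδ0 : 0 < δ := div_pos (by linarith) (by linarith)
    have h1 := hM (q + δ • r) (fun t ht => by
      rw [tP_add, tP_smul, hr t ht]
      linarith [hq t ht])
    rw [map_add, map_smul, smul_eq_mul] at h1
    have h2 : δ * (2 * (1 + |M r|)) = -(M q) := div_mul_cancel₀ _ (by positivity)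
    have h3 : δ * M r ≤ δ * |M r| := mul_le_mul_of_nonneg_left (le_abs_self _) hδ0.le
    nlinarith
  choose ℓ hℓ using fun z => tP_interp hab hT Z hZc hZI (fun t => if t = z then 1 else 0)
  refine ⟨fun z => M (ℓ z), fun z hz => hM' _ fun t ht => ?_, fun q => ?_⟩
  · rw [hℓ z t ht]; split_ifs <;> norm_num
  · set s := ∑ z ∈ Z, tP g q z • ℓ z with hs
    have hsval : ∀ t ∈ Z, tP g s t = tP g q t := by
      intro t ht
      have : tP g s t = tPlin g t s := rfl
      rw [this, hs, map_sum]
      have h2 : ∀ z ∈ Z, tPlin g t (tP g q z • ℓ z) = if t = z then tP g q z else 0 := by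
        intro z hz
        rw [map_smul, smul_eq_mul]
        change tP g q z * tP g (ℓ z) t = _
        rw [hℓ z t ht]; split_ifs <;> simp
      rw [Finset.sum_congr rfl h2]
      simp [ht]
    have h1 := hM' (q - s) (fun t ht => by
      have : tP g (q - s) t = tPlin g t (q - s) := rfl
      rw [this, map_sub]
      change 0 ≤ tP g q t - tP g s t
      rw [hsval t ht]; simp)
    have h2 := hM' (s - q) (fun t ht => by
      have : tP g (s - q) t = tPlin g t (s - q) := rfl
      rw [this, map_sub]
      change 0 ≤ tP g s t - tP g q t
      rw [hsval t ht]; simp)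
    rw [map_sub] at h1 h2
    have h3 : M q = M s := by linarith
    rw [h3, hs, map_sum]
    refine Finset.sum_congr rfl fun z _ => ?_
    rw [map_smul, smul_eq_mul, mul_comm]

theorem quadrature {a b : ℝ} (hab : a < b) {m N : ℕ} (hN : N = 2 * m + 1 + 1)
    {g : Fin N → ℝ → ℝ} (hg : ∀ j, Continuous (g j)) (hT : IsTchebyshevSystem a b g) :
    ∃ (x w : Fin (m + 1 + 1) → ℝ), x 0 = a ∧ x (Fin.last (m + 1)) = b ∧ StrictMono x ∧
      (∀ k, 0 < w k) ∧ ∀ c, ∑ k, w k * tP g c (x k) = tL a b g c := by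
  classical
  -- extremal polynomial
  set K : Set (Fin N → ℝ) := Metric.sphere 0 1 ∩ {c | ∀ t ∈ Set.Icc a b, 0 ≤ tP g c t} with hK
  have hclosed : IsClosed {c : Fin N → ℝ | ∀ t ∈ Set.Icc a b, 0 ≤ tP g c t} := by
    simp only [Set.ofPred_forall]
    exact isClosed_iInter fun t => isClosed_iInter fun _ =>
      isClosed_le continuous_const (tP_continuous_coef g t)
  have hKc : IsCompact K := (isCompact_sphere _ _).inter_right hclosed
  have hKnz : ∀ c ∈ K, c ≠ 0 := by
    rintro c ⟨h, -⟩ rfl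
    simp at h
  have hnorm : ∀ c : Fin N → ℝ, c ≠ 0 → (∀ t ∈ Set.Icc a b, 0 ≤ tP g c t) → (‖c‖)⁻¹ • c ∈ K := by
    intro c hc hpos
    have h0 : ‖c‖ ≠ 0 := norm_ne_zero_iff.2 hc
    refine ⟨by simp [norm_smul, h0], fun t ht => ?_⟩
    rw [tP_smul]
    exact mul_nonneg (by positivity) (hpos t ht)
  have hKne : K.Nonempty := by
    obtain ⟨S, hS, hSc⟩ := (Set.Ico_infinite hab).exists_subset_card_eq m
    obtain ⟨c, hc, hpos, -⟩ := exists_nonneg_poly hab hN hg hT S hSc (fun t ht => hS ht)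
    exact ⟨_, hnorm c hc hpos⟩
  have hLc : Continuous (tL a b g) :=
    (tLlin a b g hg).continuous_of_finiteDimensional
  have hLpos : ∀ c ∈ K, 0 < tL a b g c := fun c hc => tL_pos hab hg hT c (hKnz c hc) hc.2
  obtain ⟨p, hpK, hpmax⟩ := hKc.exists_isMaxOn hKne
    (f := fun c => tP g c b / tL a b g c)
    (ContinuousOn.div (tP_continuous_coef g b).continuousOn hLc.continuousOn
      (fun c hc => (hLpos c hc).ne'))
  set μ := tP g p b / tL a b g p with hμ
  have hp0 : p ≠ 0 := hKnz p hpK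
  have hLp := hLpos p hpK
  have hbI : b ∈ Set.Icc a b := ⟨hab.le, le_rfl⟩
  have hμp : tP g p b = μ * tL a b g p := by rw [hμ, div_mul_cancel₀ _ hLp.ne']
  have hmax : ∀ c, (∀ t ∈ Set.Icc a b, 0 ≤ tP g c t) → tP g c b ≤ μ * tL a b g c := by
    intro c hpos
    by_cases hc : c = 0
    · subst hc
      have h1 : tL a b g 0 = 0 := (tLlin a b g hg).map_zero
      rw [tP_zero, h1, mul_zero]
    · have h1 := hpmax (hnorm c hc hpos)
      simp only [Set.mem_ofPred_eq] at h1
      have h0 : (‖c‖)⁻¹ ≠ 0 := inv_ne_zero (norm_ne_zero_iff.2 hc)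
      rw [tP_smul, tL_smul, mul_div_mul_left _ _ h0] at h1
      rwa [div_le_iff₀ (tL_pos hab hg hT c hc hpos)] at h1
  obtain ⟨Z, hZc, hZ⟩ := tP_zeros hT p hp0
  have hZI : ∀ t ∈ Z, t ∈ Set.Icc a b := fun t ht => ((hZ t).1 ht).1
  set M : (Fin N → ℝ) →ₗ[ℝ] ℝ := μ • tLlin a b g hg - tPlin g b with hM
  have hMv : ∀ q, M q = μ * tL a b g q - tP g q b := fun q => rfl
  have hMpos : ∀ q, (∀ t ∈ Z, 0 < tP g q t) → 0 ≤ M q := by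
    intro q hq
    obtain ⟨ε, hε, hpq⟩ := perturb (tP_continuous hg p) (tP_continuous hg q) hpK.2
      (fun t ht h0 => hq t ((hZ t).2 ⟨ht, h0⟩))
    have h1 := hmax (p + ε • q) (fun t ht => by rw [tP_add, tP_smul]; exact hpq t ht)
    rw [tP_add, tP_smul, tL_add hg, tL_smul, hμp] at h1
    rw [hMv]
    by_contra hcon
    rw [not_le] at hcon
    nlinarith
  have hμ0 : 0 ≤ μ := div_nonneg (hpK.2 b hbI) hLp.le
  have hμpos : 0 < μ := by
    rcases hμ0.lt_or_eq with h | h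
    · exact h
    · exfalso
      obtain ⟨r, hr⟩ := tP_interp hab hT Z hZc hZI (fun _ => 1)
      have h1 := hMpos r (fun t ht => by rw [hr t ht]; exact one_pos)
      have hbZ : b ∈ Z := (hZ b).2 ⟨hbI, by rw [hμp, ← h, zero_mul]⟩
      rw [hMv, ← h, hr b hbZ] at h1
      linarith
  have hbZ : b ∉ Z := by
    intro h
    have h1 := ((hZ b).1 h).2
    rw [hμp] at h1
    exact (mul_pos hμpos hLp).ne' h1
  have hZIco : ∀ t ∈ Z, t ∈ Set.Ico a b := fun t ht =>
    ⟨(hZI t ht).1, lt_of_le_of_ne (hZI t ht).2 fun h => hbZ (h ▸ ht)⟩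
  obtain ⟨w, hw0, hw⟩ := farkas_interp hab hT Z hZc hZI M hMpos
  have hrep : ∀ q, μ * tL a b g q = tP g q b + ∑ z ∈ Z, w z * tP g q z := fun q => by
    rw [← hw, hMv]; ring
  -- counting
  have hinter : ∀ T ⊆ Z, (∀ t ∈ T, t ≠ a) → T.card = m + 1 → False := by
    intro T hTZ hTa hTc
    refine no_n_interior (n := m + 1) (by omega) (by omega) hab hg hT p hp0 hpK.2 T hTc ?_ ?_
    · intro t ht
      have := hZIco t (hTZ ht)
      exact ⟨lt_of_le_of_ne this.1 (hTa t ht).symm, this.2⟩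
    · exact fun t ht => ((hZ t).1 (hTZ ht)).2
  have hZle : Z.card ≤ m + 1 := by
    by_contra hlt
    have h1 : m + 1 ≤ (Z.erase a).card := by
      have := Finset.pred_card_le_card_erase (s := Z) (a := a)
      omega
    obtain ⟨T, hTs, hTc⟩ := Finset.exists_subset_card_eq h1
    exact hinter T (hTs.trans (Finset.erase_subset _ _))
      (fun t ht => (Finset.mem_erase.1 (hTs ht)).1) hTc
  have hlow : m + 1 ≤ (Z.filter fun z => 0 < w z).card := by
    by_contra hlt
    obtain ⟨S, hSS, hSI, hSc⟩ := finset_extend (Set.Ico_infinite hab) (Z.filter fun z => 0 < w z)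
      (fun t ht => hZIco t (Finset.mem_filter.1 ht).1) (k := m) (by omega)
    obtain ⟨c, hc, hpos, hcS, hcb⟩ := exists_nonneg_poly hab hN hg hT S hSc (fun t ht => hSI ht)
    have h1 := hrep c
    have h2 : ∑ z ∈ Z, w z * tP g c z = 0 := by
      refine Finset.sum_eq_zero fun z hz => ?_
      rcases (hw0 z hz).lt_or_eq with h | h
      · rw [hcS z (hSS (Finset.mem_filter.2 ⟨hz, h⟩)), mul_zero]
      · rw [← h, zero_mul]
    rw [h2, hcb, add_zero] at h1
    exact (mul_pos hμpos (tL_pos hab hg hT c hc hpos)).ne' h1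
  have hfeq : (Z.filter fun z => 0 < w z) = Z :=
    Finset.eq_of_subset_of_card_le (Finset.filter_subset _ _) (by omega)
  have hZcard : Z.card = m + 1 := by rw [hfeq] at hlow; omega
  have hwpos : ∀ z ∈ Z, 0 < w z := fun z hz => by
    rw [← hfeq] at hz; exact (Finset.mem_filter.1 hz).2
  have haZ : a ∈ Z := by
    by_contra h
    exact hinter Z subset_rfl (fun t ht h' => h (h' ▸ ht)) hZcard
  have hWc : (insert b Z).card = m + 1 + 1 := by rw [Finset.card_insert_of_notMem hbZ, hZcard]
  set x := (insert b Z).orderEmbOfFin hWc with hx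
  have hxmem : ∀ k, x k ∈ insert b Z := fun k => Finset.orderEmbOfFin_mem _ hWc k
  have hxI : ∀ k, x k ∈ Set.Icc a b := fun k => by
    rcases Finset.mem_insert.1 (hxmem k) with h | h
    · rw [h]; exact hbI
    · exact hZI _ h
  have hxsurj : ∀ t ∈ insert b Z, ∃ k, x k = t := by
    intro t ht
    have : t ∈ Set.range x := by rw [hx, Finset.range_orderEmbOfFin]; exact ht
    exact this
  set W : ℝ → ℝ := fun t => if t = b then μ⁻¹ else μ⁻¹ * w t with hW
  refine ⟨x, fun k => W (x k), ?_, ?_, x.strictMono, fun k => ?_, fun c => ?_⟩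
  · obtain ⟨k, hk⟩ := hxsurj a (Finset.mem_insert_of_mem haZ)
    exact le_antisymm (hk ▸ x.monotone (Fin.zero_le k)) (hxI 0).1
  · obtain ⟨k, hk⟩ := hxsurj b (Finset.mem_insert_self _ _)
    refine le_antisymm (hxI _).2 ?_
    calc b = x k := hk.symm
      _ ≤ _ := x.monotone (Fin.le_last k)
  · simp only [hW]
    split_ifs with h
    · positivity
    · have := hwpos (x k) ((Finset.mem_insert.1 (hxmem k)).resolve_left h)
      positivity
  · have h1 : ∑ k, W (x k) * tP g c (x k) = ∑ t ∈ insert b Z, W t * tP g c t := by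
      rw [← Finset.image_orderEmbOfFin_univ (insert b Z) hWc, Finset.sum_image]
      exact fun i _ j _ h => x.injective h
    rw [h1, Finset.sum_insert hbZ]
    have h2 : ∑ t ∈ Z, W t * tP g c t = μ⁻¹ * ∑ t ∈ Z, w t * tP g c t := by
      rw [Finset.mul_sum]
      refine Finset.sum_congr rfl fun t ht => ?_
      have : t ≠ b := fun h => hbZ (h ▸ ht)
      simp [hW, this, mul_assoc]
    rw [h2]
    have h3 := hrep c
    have h4 : W b = μ⁻¹ := by simp [hW]
    rw [h4, ← mul_add, ← h3, inv_mul_cancel_left₀ hμpos.ne']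

end TchebHelpers

/-- Antisymmetric extension. -/
theorem antisymm_extend {ι V : Type*} [Fintype ι] [DecidableEq ι] [AddCommGroup V] [Module ℝ V]
    (E T : V →ₗ[ℝ] (ι → ℝ)) (hE : Function.Injective E)
    (hrel : ∀ f h, E f ⬝ᵥ T h + E h ⬝ᵥ T f = 0) :
    ∃ S : Matrix ι ι ℝ, S + Sᵀ = 0 ∧ ∀ f, S *ᵥ E f = T f := by
  obtain ⟨A, hA⟩ := E.exists_leftInverse_of_injective (LinearMap.ker_eq_bot.2 hE)
  have hA' : ∀ f, A (E f) = f := fun f => LinearMap.congr_fun hA f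
  set TA := LinearMap.toMatrix' (T ∘ₗ A) with hTA
  set PM := LinearMap.toMatrix' (E ∘ₗ A) with hPM
  have hTAv : ∀ v, TA *ᵥ v = T (A v) := fun v => by rw [hTA, LinearMap.toMatrix'_mulVec]; rfl
  have hTAe : ∀ k i, TA k i = T (A (Pi.single i 1)) k := fun k i => by
    simp [hTA, LinearMap.toMatrix'_apply]
  have hPMe : ∀ k i, PM k i = E (A (Pi.single i 1)) k := fun k i => by
    simp [hPM, LinearMap.toMatrix'_apply]
  refine ⟨TA - TAᵀ - PMᵀ * TA, ?_, fun f => ?_⟩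
  · ext i j
    have h := hrel (A (Pi.single i 1)) (A (Pi.single j 1))
    simp only [dotProduct] at h
    simp only [Matrix.add_apply, Matrix.sub_apply, Matrix.transpose_apply, Matrix.mul_apply,
      Matrix.zero_apply, hPMe]
    simp only [hTAe]
    linarith
  · ext i
    have h := hrel (A (Pi.single i 1)) f
    rw [Matrix.sub_mulVec, Matrix.sub_mulVec, ← Matrix.mulVec_mulVec, hTAv, hA']
    have h1 : (TAᵀ *ᵥ E f) i = E f ⬝ᵥ T (A (Pi.single i 1)) := by
      simp only [Matrix.mulVec, dotProduct, Matrix.transpose_apply, hTAe, mul_comm]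
    have h2 : (PMᵀ *ᵥ T f) i = E (A (Pi.single i 1)) ⬝ᵥ T f := by
      simp only [Matrix.mulVec, dotProduct, Matrix.transpose_apply, hPMe]
    simp only [Pi.sub_apply, h1, h2]
    linarith

/-- If `(FF)'` is spanned by a Tchebyshev system `g 1, …, g 2n` on `[a,b]`, then
there is a closed positive `(n+1)`-point quadrature rule exact for `(FF)'`, and if
moreover the evaluation of `F` at these nodes is injective, a closed diagonal-norm
`F`-based SBP operator of dimension `n+1` with these nodes and weights exists. -/
theorem tchebyshev_span_yields_closed_sbp_operator
    (a b : ℝ) (hab : a < b)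
    (F : Submodule ℝ (ℝ → ℝ)) (hFC1 : ∀ f ∈ F, ContDiff ℝ 1 f)
    (hFfin : FiniteDimensional ℝ F)
    (n : ℕ) (hn : 1 ≤ n) (g : Fin (2 * n) → ℝ → ℝ)
    (hspan : Submodule.span ℝ (Set.range g) =
      Submodule.span ℝ {h : ℝ → ℝ | ∃ f ∈ F, ∃ f' ∈ F, h = deriv (fun y => f y * f' y)})
    (hT : IsTchebyshevSystem a b g) :
    ∃ (x w : Fin (n + 1) → ℝ), x 0 = a ∧ x (Fin.last n) = b ∧ StrictMono x ∧
      (∀ k, 0 < w k) ∧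
      (∀ f ∈ F, ∀ f' ∈ F,
        ∑ k, w k * deriv (fun y => f y * f' y) (x k) = f b * f' b - f a * f' a) ∧
      ((∀ f ∈ F, (∀ k, f (x k) = 0) → f = 0) →
        ∃ Q : Matrix (Fin (n + 1)) (Fin (n + 1)) ℝ,
          Q + Qᵀ = sbpBoundaryMatrix n ∧
          ∀ f ∈ F, ((Matrix.diagonal w)⁻¹ * Q) *ᵥ (fun k => f (x k)) =
            fun k => deriv f (x k)) := by
  obtain ⟨m, rfl⟩ : ∃ m, n = m + 1 := ⟨n - 1, by omega⟩
  have hdiff : ∀ f ∈ F, Differentiable ℝ f := fun f hf => (hFC1 f hf).differentiable (by simp)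
  have hprod : ∀ f ∈ F, ∀ h ∈ F, ContDiff ℝ 1 (fun y => f y * h y) := fun f hf h hh =>
    (hFC1 f hf).mul (hFC1 h hh)
  have hcontd : ∀ f ∈ F, ∀ h ∈ F, Continuous (deriv (fun y => f y * h y)) := fun f hf h hh =>
    (hprod f hf h hh).continuous_deriv le_rfl
  have hg : ∀ j, Continuous (g j) := by
    intro j
    have hmem : g j ∈ Submodule.span ℝ {h : ℝ → ℝ | ∃ f ∈ F, ∃ f' ∈ F,
        h = deriv (fun y => f y * f' y)} := by
      rw [← hspan]; exact Submodule.subset_span ⟨j, rfl⟩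
    generalize g j = v at hmem
    induction hmem using Submodule.span_induction with
    | mem u hu =>
      obtain ⟨f, hf, h, hh, rfl⟩ := hu
      exact hcontd f hf h hh
    | zero => exact continuous_zero
    | add u v _ _ hu hv => exact hu.add hv
    | smul r u _ hu => exact hu.const_smul r
  obtain ⟨x, w, hx0, hxl, hxm, hw, hquad⟩ := quadrature hab (m := m) (by ring) hg hT
  have hex : ∀ f ∈ F, ∀ f' ∈ F,
      ∑ k, w k * deriv (fun y => f y * f' y) (x k) = f b * f' b - f a * f' a := by
    intro f hf h hh
    have hmem : deriv (fun y => f y * h y) ∈ Submodule.span ℝ (Set.range g) := by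
      rw [hspan]; exact Submodule.subset_span ⟨f, hf, h, hh, rfl⟩
    obtain ⟨c, hc⟩ := (Submodule.mem_span_range_iff_exists_fun ℝ).1 hmem
    have hc' : ∀ t, tP g c t = deriv (fun y => f y * h y) t := fun t => by
      rw [← hc]; simp [tP]
    have h1 := hquad c
    unfold tL at h1
    simp only [hc'] at h1
    rw [h1, intervalIntegral.integral_deriv_eq_sub
      (fun t _ => ((hprod f hf h hh).differentiable (by simp)) t)
      ((hcontd f hf h hh).intervalIntegrable _ _)]
  refine ⟨x, w, hx0, hxl, hxm, hw, hex, fun hinj => ?_⟩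
  set β : Fin (m + 1 + 1) → ℝ := fun i =>
    (if i = Fin.last (m + 1) then (1 : ℝ) else 0) + (if i = 0 then -1 else 0) with hβ
  let E : F →ₗ[ℝ] (Fin (m + 1 + 1) → ℝ) :=
    { toFun := fun f k => f.1 (x k)
      map_add' := fun f h => rfl
      map_smul' := fun r f => rfl }
  let T : F →ₗ[ℝ] (Fin (m + 1 + 1) → ℝ) :=
    { toFun := fun f k => w k * deriv f.1 (x k) - β k / 2 * f.1 (x k)
      map_add' := fun f h => by
        ext k
        have h1 : deriv (f + h).1 (x k) = deriv f.1 (x k) + deriv h.1 (x k) :=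
          deriv_add (hdiff _ f.2 _) (hdiff _ h.2 _)
        have h2 : (f + h).1 (x k) = f.1 (x k) + h.1 (x k) := rfl
        simp only [Pi.add_apply]
        rw [h1, h2]; ring
      map_smul' := fun r f => by
        ext k
        have h1 : deriv (r • f).1 (x k) = r * deriv f.1 (x k) :=
          deriv_const_smul r (hdiff _ f.2 _)
        have h2 : (r • f).1 (x k) = r * f.1 (x k) := rfl
        simp only [Pi.smul_apply, smul_eq_mul, RingHom.id_apply]
        rw [h1, h2]; ring }
  have hE : Function.Injective E := by
    rw [injective_iff_map_eq_zero]
    intro f hf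
    exact Subtype.ext (hinj f.1 f.2 (fun k => congrFun hf k))
  have hrel : ∀ f h, E f ⬝ᵥ T h + E h ⬝ᵥ T f = 0 := by
    intro f h
    have h1 := hex f.1 f.2 h.1 h.2
    have h2 : ∀ k, deriv (fun y => f.1 y * h.1 y) (x k) =
        deriv f.1 (x k) * h.1 (x k) + f.1 (x k) * deriv h.1 (x k) := fun k =>
      deriv_fun_mul (hdiff _ f.2 _) (hdiff _ h.2 _)
    simp only [h2] at h1
    have h3 : ∑ k, β k * (f.1 (x k) * h.1 (x k)) = f.1 b * h.1 b - f.1 a * h.1 a := by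
      simp only [hβ, add_mul, Finset.sum_add_distrib, ite_mul, one_mul, zero_mul, neg_mul,
        Finset.sum_ite_eq', Finset.mem_univ, if_true, hx0, hxl]
      ring
    have h4 : E f ⬝ᵥ T h + E h ⬝ᵥ T f =
        ∑ k, w k * (deriv f.1 (x k) * h.1 (x k) + f.1 (x k) * deriv h.1 (x k)) -
        ∑ k, β k * (f.1 (x k) * h.1 (x k)) := by
      simp only [dotProduct, ← Finset.sum_add_distrib, ← Finset.sum_sub_distrib]
      refine Finset.sum_congr rfl fun k _ => ?_
      change f.1 (x k) * (w k * deriv h.1 (x k) - β k / 2 * h.1 (x k)) +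
        h.1 (x k) * (w k * deriv f.1 (x k) - β k / 2 * f.1 (x k)) = _
      ring
    rw [h4, h1, h3, sub_self]
  obtain ⟨S, hS, hST⟩ := antisymm_extend E T hE hrel
  refine ⟨S + Matrix.diagonal (fun k => β k / 2), ?_, fun f hf => ?_⟩
  · have h1 : sbpBoundaryMatrix (m + 1) = Matrix.diagonal β := rfl
    rw [h1, Matrix.transpose_add, Matrix.diagonal_transpose, add_add_add_comm, hS, zero_add,
      Matrix.diagonal_add]
    congr 1
    ext k
    ring
  · have h1 : (S + Matrix.diagonal (fun k => β k / 2)) *ᵥ (fun k => f (x k)) =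
        Matrix.diagonal w *ᵥ (fun k => deriv f (x k)) := by
      have h2 : S *ᵥ (fun k => f (x k)) = T ⟨f, hf⟩ := hST ⟨f, hf⟩
      rw [Matrix.add_mulVec, h2]
      ext k
      simp only [Pi.add_apply, Matrix.mulVec_diagonal]
      change w k * deriv f (x k) - β k / 2 * f (x k) + _ = _
      ring
    have hdet : IsUnit (Matrix.diagonal w).det := by
      rw [Matrix.det_diagonal, isUnit_iff_ne_zero]
      exact Finset.prod_ne_zero_iff.2 fun k _ => (hw k).ne'
    rw [← Matrix.mulVec_mulVec, h1, Matrix.mulVec_mulVec, Matrix.nonsing_inv_mul _ hdet,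
      Matrix.one_mulVec]
end
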